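/- arXiv:1506.06574 — 3 statements merged into one kernel-verified Lean document; each statement's English description precedes it below -/
import Mathlib

section
/- Let A be a DG Poisson algebra over a field k with Poisson bracket of degree p. Then the universal enveloping algebra A^{ue} carries a ℤ-grading determined by |M_a| = |a| and |H_a| = |a| + p for all homogeneous a ∈ A (all defining relations being homogeneous for this grading), and the degree-1 k-linear map d on A^{ue} defined on generators by d(M_a) = M_{d_A(a)} and d(H_a) = H_{d_A(a)} is well defined (it preserves all five defining relations) and makes A^{ue} a DG algebra, i.e. d² = 0 and d(xy) = d(x)y + (−1)^{|x|} x d(y) for all homogeneous x, y ∈ A^{ue}. -/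
noncomputable section

/-- A (graded-commutative) DG Poisson algebra structure, with Poisson bracket of degree `p`,
on a `ℤ`-graded `k`-algebra `A` with grading `𝒜`, differential `dA` and bracket `br`.
All axioms are stated for homogeneous elements, and signs are the Koszul signs. -/
structure IsDGPoissonAlgebra (k : Type) [Field k] (A : Type) [Ring A] [Algebra k A]
    (𝒜 : ℤ → Submodule k A) (dA : A →ₗ[k] A)
    (br : A →ₗ[k] A →ₗ[k] A) (p : ℤ) : Prop where
  comm : ∀ (i j : ℤ) (a b : A), a ∈ 𝒜 i → b ∈ 𝒜 j →
    a * b = ((-1 : k) ^ (i * j)) • (b * a)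
  d_mem : ∀ (i : ℤ) (a : A), a ∈ 𝒜 i → dA a ∈ 𝒜 (i + 1)
  d_sq : ∀ a : A, dA (dA a) = 0
  d_mul : ∀ (i j : ℤ) (a b : A), a ∈ 𝒜 i → b ∈ 𝒜 j →
    dA (a * b) = dA a * b + ((-1 : k) ^ i) • (a * dA b)
  br_mem : ∀ (i j : ℤ) (a b : A), a ∈ 𝒜 i → b ∈ 𝒜 j → br a b ∈ 𝒜 (i + j + p)
  antisymm : ∀ (i j : ℤ) (a b : A), a ∈ 𝒜 i → b ∈ 𝒜 j →
    br a b = -(((-1 : k) ^ ((i + p) * (j + p))) • br b a)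
  jacobi : ∀ (i j l : ℤ) (a b c : A), a ∈ 𝒜 i → b ∈ 𝒜 j → c ∈ 𝒜 l →
    br a (br b c) = br (br a b) c + ((-1 : k) ^ ((i + p) * (j + p))) • br b (br a c)
  d_br : ∀ (i j : ℤ) (a b : A), a ∈ 𝒜 i → b ∈ 𝒜 j →
    dA (br a b) = br (dA a) b + ((-1 : k) ^ (i + p)) • br a (dA b)
  poisson : ∀ (i j l : ℤ) (a b c : A), a ∈ 𝒜 i → b ∈ 𝒜 j → c ∈ 𝒜 l →
    br a (b * c) = br a b * c + ((-1 : k) ^ ((i + p) * j)) • (b * br a c)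

/-- A (not necessarily commutative) DG algebra structure on a `ℤ`-graded `k`-algebra. -/
structure IsDGAlgebra (k : Type) [Field k] (B : Type) [Ring B] [Algebra k B]
    (ℬ : ℤ → Submodule k B) (dB : B →ₗ[k] B) : Prop where
  graded_monoid : SetLike.GradedMonoid ℬ
  decomp : Nonempty (DirectSum.Decomposition ℬ)
  d_mem : ∀ (i : ℤ) (x : B), x ∈ ℬ i → dB x ∈ ℬ (i + 1)
  d_sq : ∀ x : B, dB (dB x) = 0
  d_mul : ∀ (i j : ℤ) (x y : B), x ∈ ℬ i → y ∈ ℬ j →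
    dB (x * y) = dB x * y + ((-1 : k) ^ i) • (x * dB y)
/-- The defining relations of the universal enveloping algebra of a DG Poisson algebra,
inside the free algebra (tensor algebra) on two copies `M_a = ι (a,0)`, `H_a = ι (0,a)`
of the underlying vector space of `A`. -/
inductive UERel (k : Type) [Field k] (A : Type) [Ring A] [Algebra k A]
    (𝒜 : ℤ → Submodule k A) (br : A →ₗ[k] A →ₗ[k] A) (p : ℤ) :
    TensorAlgebra k (A × A) → TensorAlgebra k (A × A) → Prop
  | mul_M : ∀ (i j : ℤ) (a b : A), a ∈ 𝒜 i → b ∈ 𝒜 j →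
      UERel k A 𝒜 br p (TensorAlgebra.ι k (a * b, (0 : A)))
        (TensorAlgebra.ι k (a, (0 : A)) * TensorAlgebra.ι k (b, (0 : A)))
  | br_H : ∀ (i j : ℤ) (a b : A), a ∈ 𝒜 i → b ∈ 𝒜 j →
      UERel k A 𝒜 br p (TensorAlgebra.ι k ((0 : A), br a b))
        (TensorAlgebra.ι k ((0 : A), a) * TensorAlgebra.ι k ((0 : A), b) -
          ((-1 : k) ^ ((i + p) * (j + p))) •
            (TensorAlgebra.ι k ((0 : A), b) * TensorAlgebra.ι k ((0 : A), a)))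
  | mul_H : ∀ (i j : ℤ) (a b : A), a ∈ 𝒜 i → b ∈ 𝒜 j →
      UERel k A 𝒜 br p (TensorAlgebra.ι k ((0 : A), a * b))
        (TensorAlgebra.ι k (a, (0 : A)) * TensorAlgebra.ι k ((0 : A), b) +
          ((-1 : k) ^ (i * j)) •
            (TensorAlgebra.ι k (b, (0 : A)) * TensorAlgebra.ι k ((0 : A), a)))
  | br_M : ∀ (i j : ℤ) (a b : A), a ∈ 𝒜 i → b ∈ 𝒜 j →
      UERel k A 𝒜 br p (TensorAlgebra.ι k (br a b, (0 : A)))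
        (TensorAlgebra.ι k ((0 : A), a) * TensorAlgebra.ι k (b, (0 : A)) -
          ((-1 : k) ^ ((i + p) * j)) •
            (TensorAlgebra.ι k (b, (0 : A)) * TensorAlgebra.ι k ((0 : A), a)))
  | one_M : UERel k A 𝒜 br p (TensorAlgebra.ι k ((1 : A), (0 : A))) 1

/-- The universal enveloping algebra `A^{ue}` of a DG Poisson algebra `A`. -/
abbrev UEA (k : Type) [Field k] (A : Type) [Ring A] [Algebra k A]
    (𝒜 : ℤ → Submodule k A) (br : A →ₗ[k] A →ₗ[k] A) (p : ℤ) : Type :=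
  RingQuot (UERel k A 𝒜 br p)

/-- The canonical linear map `a ↦ M_a` into the universal enveloping algebra. -/
def ueM (k : Type) [Field k] (A : Type) [Ring A] [Algebra k A]
    (𝒜 : ℤ → Submodule k A) (br : A →ₗ[k] A →ₗ[k] A) (p : ℤ) :
    A →ₗ[k] UEA k A 𝒜 br p :=
  (RingQuot.mkAlgHom k (UERel k A 𝒜 br p)).toLinearMap.comp
    ((TensorAlgebra.ι k).comp (LinearMap.inl k A A))

/-- The canonical linear map `a ↦ H_a` into the universal enveloping algebra. -/
def ueH (k : Type) [Field k] (A : Type) [Ring A] [Algebra k A]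
    (𝒜 : ℤ → Submodule k A) (br : A →ₗ[k] A →ₗ[k] A) (p : ℤ) :
    A →ₗ[k] UEA k A 𝒜 br p :=
  (RingQuot.mkAlgHom k (UERel k A 𝒜 br p)).toLinearMap.comp
    ((TensorAlgebra.ι k).comp (LinearMap.inr k A A))

/-- The canonical DG-algebra structure on the universal enveloping algebra `A^{ue}`:
a grading `ℬ` for which `M_a` has degree `|a|` and `H_a` has degree `|a| + p`, and a
differential `D` with `D M_a = M_{dA a}`, `D H_a = H_{dA a}`, making `A^{ue}` a DG algebra. -/
structure IsUEADG (k : Type) [Field k] (A : Type) [Ring A] [Algebra k A]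
    (𝒜 : ℤ → Submodule k A) (dA : A →ₗ[k] A) (br : A →ₗ[k] A →ₗ[k] A) (p : ℤ)
    (ℬ : ℤ → Submodule k (UEA k A 𝒜 br p))
    (D : UEA k A 𝒜 br p →ₗ[k] UEA k A 𝒜 br p) : Prop where
  m_mem : ∀ (i : ℤ) (a : A), a ∈ 𝒜 i → ueM k A 𝒜 br p a ∈ ℬ i
  h_mem : ∀ (i : ℤ) (a : A), a ∈ 𝒜 i → ueH k A 𝒜 br p a ∈ ℬ (i + p)
  d_m : ∀ a : A, D (ueM k A 𝒜 br p a) = ueM k A 𝒜 br p (dA a)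
  d_h : ∀ a : A, D (ueH k A 𝒜 br p a) = ueH k A 𝒜 br p (dA a)
  dga : IsDGAlgebra k (UEA k A 𝒜 br p) ℬ D

open DirectSum

section LinearMaps

variable {k : Type} [Field k] {A : Type} [Ring A] [Algebra k A]

/-- The linear map on a graded module prescribed by a linear map on each homogeneous component. -/
def gradedLift (𝒜 : ℤ → Submodule k A) [Decomposition 𝒜]
    {B : Type} [AddCommMonoid B] [Module k B] (F : ∀ i, 𝒜 i →ₗ[k] B) : A →ₗ[k] B :=
  DirectSum.toModule k ℤ B F ∘ₗ (decomposeLinearEquiv 𝒜).toLinearMap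

theorem gradedLift_of_mem (𝒜 : ℤ → Submodule k A) [Decomposition 𝒜]
    {B : Type} [AddCommMonoid B] [Module k B] (F : ∀ i, 𝒜 i →ₗ[k] B)
    {i : ℤ} {a : A} (ha : a ∈ 𝒜 i) : gradedLift 𝒜 F a = F i ⟨a, ha⟩ := by
  lift a to 𝒜 i using ha
  simp [gradedLift, toModule_lof]

theorem neg_one_zpow_add (m n : ℤ) : (-1 : k) ^ (m + n) = (-1) ^ m * (-1) ^ n :=
  zpow_add₀ (by simp) m n

theorem neg_one_zpow_mul_self (n : ℤ) : (-1 : k) ^ n * (-1) ^ n = 1 := by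
  rw [← mul_zpow]
  simp

end LinearMaps

section SignedMatrix

variable {k : Type} [Field k] {B : Type} [Ring B] [Algebra k B]

/-- The upper triangular matrix recording an element `x` of sign `s` and its derivative `y`;
its multiplication is the signed Leibniz rule. -/
def leibnizMatrix (s : k) (x y : B) : Matrix (Fin 2) (Fin 2) B := !![s • x, y; 0, x]

theorem leibnizMatrix_mul (s t : k) (x y z w : B) :
    leibnizMatrix s x y * leibnizMatrix t z w =
      leibnizMatrix (s * t) (x * z) (y * z + s • (x * w)) := by
  ext i j
  fin_cases i <;> fin_cases j <;>
    simp [leibnizMatrix, Matrix.mul_apply, Fin.sum_univ_two, smul_smul, mul_comm, add_comm]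

theorem leibnizMatrix_add (s : k) (x y z w : B) :
    leibnizMatrix s x y + leibnizMatrix s z w = leibnizMatrix s (x + z) (y + w) := by
  ext i j
  fin_cases i <;> fin_cases j <;> simp [leibnizMatrix]

theorem leibnizMatrix_sub (s : k) (x y z w : B) :
    leibnizMatrix s x y - leibnizMatrix s z w = leibnizMatrix s (x - z) (y - w) := by
  ext i j
  fin_cases i <;> fin_cases j <;> simp [leibnizMatrix, smul_sub]

theorem smul_leibnizMatrix (c s : k) (x y : B) :
    c • leibnizMatrix s x y = leibnizMatrix s (c • x) (c • y) := by
  ext i j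
  fin_cases i <;> fin_cases j <;> simp [leibnizMatrix, smul_smul, mul_comm]

theorem leibnizMatrix_one : leibnizMatrix (1 : k) (1 : B) 0 = 1 := by
  ext i j
  fin_cases i <;> fin_cases j <;> simp [leibnizMatrix]

/-- The linear map `a ↦ leibnizMatrix s (f a) (g a)`. -/
def leibnizMatrixHom {V : Type} [AddCommGroup V] [Module k V] (s : k) (f g : V →ₗ[k] B) :
    V →ₗ[k] Matrix (Fin 2) (Fin 2) B where
  toFun a := leibnizMatrix s (f a) (g a)
  map_add' a b := by simp [leibnizMatrix_add]
  map_smul' c a := by simp [smul_leibnizMatrix]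

end SignedMatrix

namespace UEA

variable {k : Type} [Field k] {A : Type} [Ring A] [Algebra k A]
  {𝒜 : ℤ → Submodule k A} {dA : A →ₗ[k] A} {br : A →ₗ[k] A →ₗ[k] A} {p : ℤ}

/-- The relations on a pair of linear maps `f`, `g` out of `A` under which `M_a ↦ f a`,
`H_a ↦ g a` extends to the universal enveloping algebra. -/
structure IsEnvelopingPair (𝒜 : ℤ → Submodule k A) (br : A →ₗ[k] A →ₗ[k] A) (p : ℤ)
    {B : Type} [Ring B] [Algebra k B] (f g : A →ₗ[k] B) : Prop where
  mul_left : ∀ (i j : ℤ) (a b : A), a ∈ 𝒜 i → b ∈ 𝒜 j → f (a * b) = f a * f b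
  br_right : ∀ (i j : ℤ) (a b : A), a ∈ 𝒜 i → b ∈ 𝒜 j →
    g (br a b) = g a * g b - ((-1 : k) ^ ((i + p) * (j + p))) • (g b * g a)
  mul_right : ∀ (i j : ℤ) (a b : A), a ∈ 𝒜 i → b ∈ 𝒜 j →
    g (a * b) = f a * g b + ((-1 : k) ^ (i * j)) • (f b * g a)
  br_left : ∀ (i j : ℤ) (a b : A), a ∈ 𝒜 i → b ∈ 𝒜 j →
    f (br a b) = g a * f b - ((-1 : k) ^ ((i + p) * j)) • (f b * g a)
  one_left : f 1 = 1

theorem isEnvelopingPair_ueM_ueH :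
    IsEnvelopingPair 𝒜 br p (ueM k A 𝒜 br p) (ueH k A 𝒜 br p) where
  mul_left i j a b ha hb := by
    simpa [ueM, ueH] using RingQuot.mkAlgHom_rel k (UERel.mul_M i j a b ha hb)
  br_right i j a b ha hb := by
    simpa [ueM, ueH] using RingQuot.mkAlgHom_rel k (UERel.br_H i j a b ha hb)
  mul_right i j a b ha hb := by
    simpa [ueM, ueH] using RingQuot.mkAlgHom_rel k (UERel.mul_H i j a b ha hb)
  br_left i j a b ha hb := by
    simpa [ueM, ueH] using RingQuot.mkAlgHom_rel k (UERel.br_M i j a b ha hb)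
  one_left := by
    simpa [ueM, ueH] using RingQuot.mkAlgHom_rel k (UERel.one_M (𝒜 := 𝒜) (br := br) (p := p))

/-- The universal property of the universal enveloping algebra. -/
theorem exists_lift {B : Type} [Ring B] [Algebra k B] {f g : A →ₗ[k] B}
    (h : IsEnvelopingPair 𝒜 br p f g) :
    ∃ φ : UEA k A 𝒜 br p →ₐ[k] B,
      (∀ a, φ (ueM k A 𝒜 br p a) = f a) ∧ ∀ a, φ (ueH k A 𝒜 br p a) = g a := by
  have w : ∀ ⦃x y⦄, UERel k A 𝒜 br p x y →
      TensorAlgebra.lift k (f.coprod g) x = TensorAlgebra.lift k (f.coprod g) y := by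
    intro x y hxy
    cases hxy with
    | mul_M i j a b ha hb => simpa using h.mul_left i j a b ha hb
    | br_H i j a b ha hb => simpa using h.br_right i j a b ha hb
    | mul_H i j a b ha hb => simpa using h.mul_right i j a b ha hb
    | br_M i j a b ha hb => simpa using h.br_left i j a b ha hb
    | one_M => simpa using h.one_left
  refine ⟨RingQuot.liftAlgHom k ⟨_, w⟩, fun a => ?_, fun a => ?_⟩
  · simp [ueM, RingQuot.liftAlgHom_mkAlgHom_apply]
  · simp [ueH, RingQuot.liftAlgHom_mkAlgHom_apply]

theorem adjoin_range_eq_top :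
    Algebra.adjoin k (Set.range (ueM k A 𝒜 br p) ∪ Set.range (ueH k A 𝒜 br p)) = ⊤ := by
  have hsurj := (AlgHom.range_eq_top _).2 (RingQuot.mkAlgHom_surjective k (UERel k A 𝒜 br p))
  rw [eq_top_iff, ← hsurj, ← Algebra.map_top, ← TensorAlgebra.adjoin_range_ι, AlgHom.map_adjoin]
  refine Algebra.adjoin_le ?_
  rintro _ ⟨_, ⟨⟨a, b⟩, rfl⟩, rfl⟩
  have hab : RingQuot.mkAlgHom k (UERel k A 𝒜 br p) (TensorAlgebra.ι k (a, b)) =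
      ueM k A 𝒜 br p a + ueH k A 𝒜 br p b := by
    simp [ueM, ueH, ← map_add]
  exact hab ▸ add_mem (Algebra.subset_adjoin (.inl ⟨a, rfl⟩))
    (Algebra.subset_adjoin (.inr ⟨b, rfl⟩))

theorem eq_top_of_homogeneous_mem [Decomposition 𝒜] {S : Subalgebra k (UEA k A 𝒜 br p)}
    (hM : ∀ i, ∀ a ∈ 𝒜 i, ueM k A 𝒜 br p a ∈ S) (hH : ∀ i, ∀ a ∈ 𝒜 i, ueH k A 𝒜 br p a ∈ S) :
    S = ⊤ := by
  rw [eq_top_iff, ← adjoin_range_eq_top]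
  refine Algebra.adjoin_le ?_
  rintro _ (⟨a, rfl⟩ | ⟨a, rfl⟩)
  · induction a using Decomposition.inductionOn 𝒜 with
    | zero => simp
    | homogeneous a => exact hM _ a a.2
    | add a b ha hb => simpa using add_mem ha hb
  · induction a using Decomposition.inductionOn 𝒜 with
    | zero => simp
    | homogeneous a => exact hH _ a a.2
    | add a b ha hb => simpa using add_mem ha hb

theorem coeAlgHom_surjective [Decomposition 𝒜] {𝒢 : ℤ → Submodule k (UEA k A 𝒜 br p)}
    [SetLike.GradedMonoid 𝒢] (hM : ∀ i, ∀ a ∈ 𝒜 i, ueM k A 𝒜 br p a ∈ 𝒢 i)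
    (hH : ∀ i, ∀ a ∈ 𝒜 i, ueH k A 𝒜 br p a ∈ 𝒢 (i + p)) :
    Function.Surjective (DirectSum.coeAlgHom 𝒢) := by
  rw [← AlgHom.range_eq_top]
  exact eq_top_of_homogeneous_mem
    (fun i a ha => ⟨.of (fun i => 𝒢 i) i ⟨_, hM i a ha⟩, DirectSum.coeAlgHom_of ..⟩)
    (fun i a ha => ⟨.of (fun i => 𝒢 i) (i + p) ⟨_, hH i a ha⟩, DirectSum.coeAlgHom_of ..⟩)

theorem exists_coaction [GradedAlgebra 𝒜]
    (hbr : ∀ (i j : ℤ) (a b : A), a ∈ 𝒜 i → b ∈ 𝒜 j → br a b ∈ 𝒜 (i + j + p)) :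
    ∃ ρ : UEA k A 𝒜 br p →ₐ[k] AddMonoidAlgebra (UEA k A 𝒜 br p) ℤ,
      (∀ i, ∀ a ∈ 𝒜 i, ρ (ueM k A 𝒜 br p a) = .single i (ueM k A 𝒜 br p a)) ∧
      ∀ i, ∀ a ∈ 𝒜 i, ρ (ueH k A 𝒜 br p a) = .single (i + p) (ueH k A 𝒜 br p a) := by
  let M := ueM k A 𝒜 br p
  let H := ueH k A 𝒜 br p
  have key : IsEnvelopingPair 𝒜 br p M H := isEnvelopingPair_ueM_ueH
  let single (i : ℤ) :
      UEA k A 𝒜 br p →ₗ[k] AddMonoidAlgebra (UEA k A 𝒜 br p) ℤ :=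
    AddMonoidAlgebra.lsingle i
  let f : A →ₗ[k] AddMonoidAlgebra (UEA k A 𝒜 br p) ℤ :=
    gradedLift 𝒜 fun i => single i ∘ₗ M ∘ₗ (𝒜 i).subtype
  let g : A →ₗ[k] AddMonoidAlgebra (UEA k A 𝒜 br p) ℤ :=
    gradedLift 𝒜 fun i => single (i + p) ∘ₗ H ∘ₗ (𝒜 i).subtype
  have hf (i : ℤ) (a : A) (ha : a ∈ 𝒜 i) : f a = .single i (M a) := by
    simp [f, single, gradedLift_of_mem 𝒜 _ ha]
  have hg (i : ℤ) (a : A) (ha : a ∈ 𝒜 i) : g a = .single (i + p) (H a) := by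
    simp [g, single, gradedLift_of_mem 𝒜 _ ha]
  have hfg : IsEnvelopingPair (B := AddMonoidAlgebra (UEA k A 𝒜 br p) ℤ) 𝒜 br p f g :=
    { mul_left := fun i j a b ha hb => by
        rw [hf _ _ (SetLike.mul_mem_graded ha hb), hf _ _ ha, hf _ _ hb,
          AddMonoidAlgebra.single_mul_single, key.mul_left i j a b ha hb]
      br_right := fun i j a b ha hb => by
        rw [hg _ _ (hbr i j a b ha hb), hg _ _ ha, hg _ _ hb,
          AddMonoidAlgebra.single_mul_single, AddMonoidAlgebra.single_mul_single,
          key.br_right i j a b ha hb, AddMonoidAlgebra.smul_single, add_comm (j + p),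
          ← AddMonoidAlgebra.single_sub, show i + j + p + p = i + p + (j + p) by ring]
      mul_right := fun i j a b ha hb => by
        rw [hg _ _ (SetLike.mul_mem_graded ha hb), hf _ _ ha, hf _ _ hb, hg _ _ ha, hg _ _ hb,
          AddMonoidAlgebra.single_mul_single, AddMonoidAlgebra.single_mul_single,
          key.mul_right i j a b ha hb, AddMonoidAlgebra.smul_single, add_left_comm j,
          ← AddMonoidAlgebra.single_add, add_assoc]
      br_left := fun i j a b ha hb => by
        rw [hf _ _ (hbr i j a b ha hb), hf _ _ hb, hg _ _ ha,
          AddMonoidAlgebra.single_mul_single, AddMonoidAlgebra.single_mul_single,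
          key.br_left i j a b ha hb, AddMonoidAlgebra.smul_single, add_comm j,
          ← AddMonoidAlgebra.single_sub, add_right_comm]
      one_left := by
        rw [hf 0 1 SetLike.GradedOne.one_mem, key.one_left, AddMonoidAlgebra.one_def] }
  obtain ⟨ρ, hρM, hρH⟩ := exists_lift hfg
  exact ⟨ρ, fun i a ha => (hρM a).trans (hf i a ha), fun i a ha => (hρH a).trans (hg i a ha)⟩

theorem exists_leibnizHom [GradedAlgebra 𝒜] (hA : IsDGPoissonAlgebra k A 𝒜 dA br p) :
    ∃ Φ : UEA k A 𝒜 br p →ₐ[k] Matrix (Fin 2) (Fin 2) (UEA k A 𝒜 br p),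
      (∀ i, ∀ a ∈ 𝒜 i, Φ (ueM k A 𝒜 br p a) =
        leibnizMatrix ((-1 : k) ^ i) (ueM k A 𝒜 br p a) (ueM k A 𝒜 br p (dA a))) ∧
      ∀ i, ∀ a ∈ 𝒜 i, Φ (ueH k A 𝒜 br p a) =
        leibnizMatrix ((-1 : k) ^ (i + p)) (ueH k A 𝒜 br p a) (ueH k A 𝒜 br p (dA a)) := by
  let M := ueM k A 𝒜 br p
  let H := ueH k A 𝒜 br p
  have key : IsEnvelopingPair 𝒜 br p M H := isEnvelopingPair_ueM_ueH
  let f := gradedLift 𝒜 fun i => leibnizMatrixHom ((-1 : k) ^ i) M (M ∘ₗ dA) ∘ₗ (𝒜 i).subtype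
  let g := gradedLift 𝒜 fun i =>
    leibnizMatrixHom ((-1 : k) ^ (i + p)) H (H ∘ₗ dA) ∘ₗ (𝒜 i).subtype
  have hf (i : ℤ) (a : A) (ha : a ∈ 𝒜 i) :
      f a = leibnizMatrix ((-1 : k) ^ i) (M a) (M (dA a)) := by
    simp [f, leibnizMatrixHom, gradedLift_of_mem 𝒜 _ ha]
  have hg (i : ℤ) (a : A) (ha : a ∈ 𝒜 i) :
      g a = leibnizMatrix ((-1 : k) ^ (i + p)) (H a) (H (dA a)) := by
    simp [g, leibnizMatrixHom, gradedLift_of_mem 𝒜 _ ha]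
  have sq (n : ℤ) : (-1 : k) ^ n * (-1) ^ n = 1 := neg_one_zpow_mul_self n
  have hfg : IsEnvelopingPair 𝒜 br p f g :=
    { mul_left := fun i j a b ha hb => by
        rw [hf _ _ (SetLike.mul_mem_graded ha hb), hf _ _ ha, hf _ _ hb,
          leibnizMatrix_mul, hA.d_mul i j a b ha hb, map_add, map_smul, key.mul_left i j a b ha hb,
          key.mul_left _ _ _ _ (hA.d_mem _ _ ha) hb, key.mul_left _ _ _ _ ha (hA.d_mem _ _ hb),
          neg_one_zpow_add]
      br_right := fun i j a b ha hb => by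
        rw [hg _ _ (hA.br_mem i j a b ha hb), hg _ _ ha, hg _ _ hb,
          leibnizMatrix_mul, leibnizMatrix_mul, smul_leibnizMatrix,
          mul_comm ((-1 : k) ^ (j + p)), leibnizMatrix_sub, hA.d_br i j a b ha hb, map_add,
          map_smul, key.br_right i j a b ha hb,
          key.br_right _ _ _ _ (hA.d_mem _ _ ha) hb, key.br_right _ _ _ _ ha (hA.d_mem _ _ hb),
          ← neg_one_zpow_add, show i + j + p + p = i + p + (j + p) by ring,
          show (i + 1 + p) * (j + p) = (i + p) * (j + p) + (j + p) by ring,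
          show (i + p) * (j + 1 + p) = (i + p) * (j + p) + (i + p) by ring,
          neg_one_zpow_add ((i + p) * (j + p)), neg_one_zpow_add ((i + p) * (j + p))]
        congr 1
        linear_combination (norm := module)
          (-(-1 : k) ^ ((i + p) * (j + p)) * sq (i + p)) • (H (dA b) * H a)
      mul_right := fun i j a b ha hb => by
        rw [hg _ _ (SetLike.mul_mem_graded ha hb), hf _ _ ha, hf _ _ hb, hg _ _ ha, hg _ _ hb,
          leibnizMatrix_mul, leibnizMatrix_mul, smul_leibnizMatrix,
          ← neg_one_zpow_add, ← neg_one_zpow_add, add_left_comm j, add_assoc,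
          leibnizMatrix_add, hA.d_mul i j a b ha hb, map_add,
          map_smul, key.mul_right i j a b ha hb,
          key.mul_right _ _ _ _ (hA.d_mem _ _ ha) hb, key.mul_right _ _ _ _ ha (hA.d_mem _ _ hb),
          show (i + 1) * j = i * j + j by ring, show i * (j + 1) = i * j + i by ring,
          neg_one_zpow_add (i * j), neg_one_zpow_add (i * j)]
        congr 1
        linear_combination (norm := module) ((-1 : k) ^ (i * j) * sq i) • (M (dA b) * H a)
      br_left := fun i j a b ha hb => by
        rw [hf _ _ (hA.br_mem i j a b ha hb), hf _ _ hb, hg _ _ ha,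
          leibnizMatrix_mul, leibnizMatrix_mul, smul_leibnizMatrix,
          mul_comm ((-1 : k) ^ j), leibnizMatrix_sub, hA.d_br i j a b ha hb, map_add,
          map_smul, key.br_left i j a b ha hb,
          key.br_left _ _ _ _ (hA.d_mem _ _ ha) hb, key.br_left _ _ _ _ ha (hA.d_mem _ _ hb),
          ← neg_one_zpow_add, add_right_comm i j p,
          show (i + 1 + p) * j = (i + p) * j + j by ring,
          show (i + p) * (j + 1) = (i + p) * j + (i + p) by ring,
          neg_one_zpow_add ((i + p) * j), neg_one_zpow_add ((i + p) * j)]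
        congr 1
        linear_combination (norm := module)
          (-(-1 : k) ^ ((i + p) * j) * sq (i + p)) • (M (dA b) * H a)
      one_left := by
        have h1 : (1 : A) ∈ 𝒜 0 := SetLike.GradedOne.one_mem
        have hd : dA 1 = 0 := by simpa using hA.d_mul 0 0 1 1 h1 h1
        rw [hf 0 1 h1, key.one_left, hd, map_zero, zpow_zero, leibnizMatrix_one] }
  obtain ⟨Φ, hΦM, hΦH⟩ := exists_lift hfg
  exact ⟨Φ, fun i a ha => (hΦM a).trans (hf i a ha), fun i a ha => (hΦH a).trans (hg i a ha)⟩

section Weight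

variable {B : Type} [Ring B] [Algebra k B]

/-- The homogeneous elements of degree `i` for a coaction `ρ` of the group algebra of `ℤ`. -/
def weightSpace (ρ : B →ₐ[k] AddMonoidAlgebra B ℤ) (i : ℤ) : Submodule k B where
  carrier := {x | ρ x = .single i x}
  zero_mem' := by simp
  add_mem' {x y} hx hy := by
    rw [Set.mem_ofPred_eq] at *
    rw [map_add, hx, hy, AddMonoidAlgebra.single_add]
  smul_mem' c x hx := by
    rw [Set.mem_ofPred_eq] at *
    rw [map_smul, hx, AddMonoidAlgebra.smul_single]

theorem mem_weightSpace {ρ : B →ₐ[k] AddMonoidAlgebra B ℤ} {i : ℤ} {x : B} :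
    x ∈ weightSpace ρ i ↔ ρ x = .single i x := Iff.rfl

instance (ρ : B →ₐ[k] AddMonoidAlgebra B ℤ) : SetLike.GradedMonoid (weightSpace ρ) where
  one_mem := by rw [mem_weightSpace, map_one, AddMonoidAlgebra.one_def]
  mul_mem i j x y hx hy := by
    rw [mem_weightSpace] at *
    rw [map_mul, hx, hy, AddMonoidAlgebra.single_mul_single]

theorem coeff_coeAlgHom {ρ : B →ₐ[k] AddMonoidAlgebra B ℤ} {𝒢 : ℤ → Submodule k B}
    [SetLike.GradedMonoid 𝒢] (h𝒢 : 𝒢 ≤ weightSpace ρ) (x : ⨁ i, 𝒢 i) (i : ℤ) :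
    (ρ (DirectSum.coeAlgHom 𝒢 x)).coeff i = x i := by
  induction x using DirectSum.induction_on with
  | zero => simp
  | of j x =>
    rw [DirectSum.coeAlgHom_of, mem_weightSpace.1 (h𝒢 j x.2), AddMonoidAlgebra.coeff_single,
      Finsupp.single_apply, DirectSum.coe_of_apply]
    split_ifs <;> simp
  | add x y hx hy => simp [hx, hy]

theorem weightSpace_le {ρ : B →ₐ[k] AddMonoidAlgebra B ℤ} {𝒢 : ℤ → Submodule k B}
    [SetLike.GradedMonoid 𝒢] (h𝒢 : 𝒢 ≤ weightSpace ρ)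
    (hsurj : Function.Surjective (DirectSum.coeAlgHom 𝒢)) : weightSpace ρ ≤ 𝒢 := by
  intro i x hx
  obtain ⟨y, rfl⟩ := hsurj x
  have hy := coeff_coeAlgHom h𝒢 y i
  rw [mem_weightSpace.1 hx, AddMonoidAlgebra.coeff_single, Finsupp.single_eq_same] at hy
  exact hy ▸ (y i).2

theorem weightSpace_decomposition {ρ : B →ₐ[k] AddMonoidAlgebra B ℤ}
    (hsurj : Function.Surjective (DirectSum.coeAlgHom (weightSpace ρ))) :
    Nonempty (Decomposition (weightSpace ρ)) := by
  refine ⟨DirectSum.IsInternal.chooseDecomposition _ ⟨fun x y hxy => ?_, hsurj⟩⟩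
  refine DFinsupp.ext fun i => Subtype.ext ?_
  rw [← coeff_coeAlgHom le_rfl x, ← coeff_coeAlgHom le_rfl y]
  exact congrArg (fun z => (ρ z).coeff i) hxy

end Weight

end UEA

/-- Let `A` be a DG Poisson algebra over a field `k` with Poisson bracket of
degree `p`.  Then the universal enveloping algebra `A^{ue}` carries a `ℤ`-grading determined by
`|M_a| = |a|`, `|H_a| = |a| + p` (the generators `M_a`, `H_a` generate `A^{ue}` and are
homogeneous of these degrees), and the degree-1 linear map `D` with `D M_a = M_{dA a}`,
`D H_a = H_{dA a}` is well defined and makes `A^{ue}` a DG algebra: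
`D ∘ D = 0` and `D (x * y) = D x * y + (-1)^{|x|} x * D y` for homogeneous `x, y`. -/
theorem ue_of_dgPoisson_isDGAlgebra
    (k : Type) [Field k] (A : Type) [Ring A] [Algebra k A]
    (𝒜 : ℤ → Submodule k A) [GradedAlgebra 𝒜] (dA : A →ₗ[k] A)
    (br : A →ₗ[k] A →ₗ[k] A) (p : ℤ)
    (hA : IsDGPoissonAlgebra k A 𝒜 dA br p) :
    ∃ (ℬ : ℤ → Submodule k (UEA k A 𝒜 br p))
      (D : UEA k A 𝒜 br p →ₗ[k] UEA k A 𝒜 br p),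
      Algebra.adjoin k
        (Set.range (ueM k A 𝒜 br p) ∪ Set.range (ueH k A 𝒜 br p)) = ⊤ ∧
      IsUEADG k A 𝒜 dA br p ℬ D := by
  let M := ueM k A 𝒜 br p
  let H := ueH k A 𝒜 br p
  obtain ⟨ρ, hρM, hρH⟩ := UEA.exists_coaction hA.br_mem
  obtain ⟨Φ, hΦM, hΦH⟩ := UEA.exists_leibnizHom hA
  let ℬ := UEA.weightSpace ρ
  let D : UEA k A 𝒜 br p →ₗ[k] UEA k A 𝒜 br p := Matrix.entryLinearMap k _ 0 1 ∘ₗ Φ.toLinearMap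
  have hDM (a : A) : D (M a) = M (dA a) := by
    induction a using DirectSum.Decomposition.inductionOn 𝒜 with
    | zero => simp
    | homogeneous a => simp [D, M, hΦM _ a a.2, leibnizMatrix]
    | add a b ha hb => simp [ha, hb]
  have hDH (a : A) : D (H a) = H (dA a) := by
    induction a using DirectSum.Decomposition.inductionOn 𝒜 with
    | zero => simp
    | homogeneous a => simp [D, H, hΦH _ a a.2, leibnizMatrix]
    | add a b ha hb => simp [ha, hb]
  have hΦ (i : ℤ) (x : UEA k A 𝒜 br p) (hx : x ∈ ℬ i) :
      Φ x = leibnizMatrix ((-1 : k) ^ i) x (D x) := by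
    let 𝒢 (i : ℤ) : Submodule k (UEA k A 𝒜 br p) :=
      ℬ i ⊓ LinearMap.eqLocus Φ.toLinearMap (leibnizMatrixHom ((-1 : k) ^ i) .id D)
    have mem_iff (i : ℤ) (x : UEA k A 𝒜 br p) :
        x ∈ 𝒢 i ↔ x ∈ ℬ i ∧ Φ x = leibnizMatrix ((-1 : k) ^ i) x (D x) := Iff.rfl
    have of_eq {i : ℤ} {x y : UEA k A 𝒜 br p} (hx : x ∈ ℬ i)
        (h : Φ x = leibnizMatrix ((-1 : k) ^ i) x y) : x ∈ 𝒢 i := by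
      have hy : D x = y := by simp [D, h, leibnizMatrix]
      exact (mem_iff i x).2 ⟨hx, hy ▸ h⟩
    have : SetLike.GradedMonoid 𝒢 :=
      { one_mem := of_eq (y := 0) SetLike.GradedOne.one_mem <| by
          rw [map_one, zpow_zero, leibnizMatrix_one]
        mul_mem := fun i j x y hx hy => by
          rw [mem_iff] at hx hy
          refine of_eq (SetLike.mul_mem_graded hx.1 hy.1) ?_ (y := D x * y + (-1 : k) ^ i • (x * D y))
          rw [map_mul, hx.2, hy.2, leibnizMatrix_mul, neg_one_zpow_add] }
    exact ((mem_iff i x).1 (UEA.weightSpace_le (fun _ => inf_le_left)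
      (UEA.coeAlgHom_surjective (fun i a ha => of_eq (hρM i a ha) (hΦM i a ha))
        (fun i a ha => of_eq (hρH i a ha) (hΦH i a ha))) i hx)).2
  have hD_mul (i : ℤ) (x y : UEA k A 𝒜 br p) (hx : x ∈ ℬ i) (j : ℤ) (hy : y ∈ ℬ j) :
      D (x * y) = D x * y + ((-1 : k) ^ i) • (x * D y) := by
    have h := hΦ _ _ (SetLike.mul_mem_graded hx hy)
    rw [map_mul, hΦ i x hx, hΦ j y hy, leibnizMatrix_mul] at h
    simpa [leibnizMatrix] using (congrFun (congrFun h 0) 1).symm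
  have hD_one : D 1 = 0 := by
    simpa using hD_mul 0 1 1 SetLike.GradedOne.one_mem 0 SetLike.GradedOne.one_mem
  let 𝒢 (i : ℤ) : Submodule k (UEA k A 𝒜 br p) :=
    ℬ i ⊓ ((ℬ (i + 1)).comap D ⊓ LinearMap.ker (D ∘ₗ D))
  have mem_iff (i : ℤ) (x : UEA k A 𝒜 br p) :
      x ∈ 𝒢 i ↔ x ∈ ℬ i ∧ D x ∈ ℬ (i + 1) ∧ D (D x) = 0 := Iff.rfl
  have : SetLike.GradedMonoid 𝒢 :=
    { one_mem := (mem_iff _ _).2 ⟨SetLike.GradedOne.one_mem, by simp [hD_one], by simp [hD_one]⟩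
      mul_mem := fun i j x y hx hy => by
        rw [mem_iff] at *
        obtain ⟨hx, hdx, hddx⟩ := hx
        obtain ⟨hy, hdy, hddy⟩ := hy
        have h₁ : D x * y ∈ ℬ (i + j + 1) :=
          add_right_comm i 1 j ▸ SetLike.mul_mem_graded hdx hy
        have h₂ : x * D y ∈ ℬ (i + j + 1) := add_assoc i j 1 ▸ SetLike.mul_mem_graded hx hdy
        refine ⟨SetLike.mul_mem_graded hx hy, ?_, ?_⟩
        · rw [hD_mul i x y hx j hy]
          exact add_mem h₁ (Submodule.smul_mem _ _ h₂)
        · rw [hD_mul i x y hx j hy, map_add, map_smul, hD_mul _ _ _ hdx _ hy,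
            hD_mul _ _ _ hx _ hdy, hddx, hddy, neg_one_zpow_add,
            zpow_one, zero_mul, mul_zero]
          module }
  have h𝒢M (i : ℤ) (a : A) (ha : a ∈ 𝒜 i) : M a ∈ 𝒢 i := by
    rw [mem_iff, hDM, hDM, hA.d_sq, map_zero]
    exact ⟨hρM i a ha, hρM _ _ (hA.d_mem i a ha), rfl⟩
  have h𝒢H (i : ℤ) (a : A) (ha : a ∈ 𝒜 i) : H a ∈ 𝒢 (i + p) := by
    rw [mem_iff, hDH, hDH, hA.d_sq, map_zero, add_right_comm]
    exact ⟨hρH i a ha, hρH _ _ (hA.d_mem i a ha), rfl⟩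
  have h𝒢 := UEA.weightSpace_le (ρ := ρ) (𝒢 := 𝒢) (fun _ => inf_le_left)
    (UEA.coeAlgHom_surjective h𝒢M h𝒢H)
  have hℬ := UEA.coeAlgHom_surjective (𝒢 := ℬ) hρM hρH
  refine ⟨ℬ, D, UEA.adjoin_range_eq_top, hρM, hρH, hDM, hDH, inferInstance,
    UEA.weightSpace_decomposition hℬ, fun i x hx => ((mem_iff i x).1 (h𝒢 i hx)).2.1,
    fun x => ?_, fun i j x y hx hy => hD_mul i x y hx j hy⟩
  obtain ⟨x, rfl⟩ := hℬ x
  induction x using DirectSum.induction_on with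
  | zero => simp
  | of i x =>
    rw [DirectSum.coeAlgHom_of]
    exact ((mem_iff i x).1 (h𝒢 i x.2)).2.2
  | add x y hx hy => simp [hx, hy]

end
end

section
/- Let A and B be DG Poisson algebras over a field k with Poisson brackets of the same degree p. The graded tensor product A ⊗ B, with multiplication (a₁⊗b₁)(a₂⊗b₂) = (−1)^{|a₂||b₁|} a₁a₂ ⊗ b₁b₂, differential d(a⊗b) = d_A(a)⊗b + (−1)^{|a|} a⊗d_B(b), and bracket {a₁⊗b₁, a₂⊗b₂}_{A⊗B} := (−1)^{(|a₂|+p)|b₁|}{a₁,a₂}_A ⊗ b₁b₂ + (−1)^{(|b₁|+p)|a₂|} a₁a₂ ⊗ {b₁,b₂}_B for homogeneous a₁, a₂ ∈ A, b₁, b₂ ∈ B, is a DG Poisson algebra with Poisson bracket of degree p. -/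
open scoped TensorProduct

noncomputable section

/-- `W`, together with the bilinear map `μ : M → N → W` (thought of as `m ⊗ n`), realizes the
tensor product of the graded vector spaces `M` and `N`: `μ` induces a linear bijection
`M ⊗[k] N ≃ W`, homogeneous tensors are homogeneous of the expected total degree, and every
homogeneous element of `W` is a sum of homogeneous tensors of that total degree. -/
structure RealizesGradedTensor (k : Type) [Field k]
    (M : Type) [AddCommGroup M] [Module k M]
    (N : Type) [AddCommGroup N] [Module k N]
    (W : Type) [AddCommGroup W] [Module k W]
    (𝒱M : ℤ → Submodule k M) (𝒱N : ℤ → Submodule k N) (𝒲 : ℤ → Submodule k W)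
    (μ : M →ₗ[k] N →ₗ[k] W) : Prop where
  bij : Function.Bijective (TensorProduct.lift μ)
  mem : ∀ (i j : ℤ) (m : M) (n : N), m ∈ 𝒱M i → n ∈ 𝒱N j → μ m n ∈ 𝒲 (i + j)
  span : ∀ nn : ℤ, (𝒲 nn : Set W) ⊆
    (Submodule.span k {w : W | ∃ (i j : ℤ) (m : M) (n : N),
      i + j = nn ∧ m ∈ 𝒱M i ∧ n ∈ 𝒱N j ∧ μ m n = w} : Submodule k W)

/-- `C`, together with the bilinear map `μ : A → B → C` (thought of as `a ⊗ b`), realizes the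
graded tensor product of the graded algebras `A` and `B`, with the Koszul-sign multiplication
`(a₁ ⊗ b₁)(a₂ ⊗ b₂) = (-1)^{|a₂||b₁|} (a₁a₂) ⊗ (b₁b₂)` and unit `1 ⊗ 1`. -/
structure RealizesGradedTensorAlg (k : Type) [Field k]
    (A : Type) [Ring A] [Algebra k A] (B : Type) [Ring B] [Algebra k B]
    (C : Type) [Ring C] [Algebra k C]
    (𝒜 : ℤ → Submodule k A) (ℬ : ℤ → Submodule k B) (𝒞 : ℤ → Submodule k C)
    (μ : A →ₗ[k] B →ₗ[k] C) : Prop where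
  toRealizesGradedTensor : RealizesGradedTensor k A B C 𝒜 ℬ 𝒞 μ
  one : μ 1 1 = 1
  mul : ∀ (i₁ j₁ i₂ j₂ : ℤ) (a₁ a₂ : A) (b₁ b₂ : B),
    a₁ ∈ 𝒜 i₁ → b₁ ∈ ℬ j₁ → a₂ ∈ 𝒜 i₂ → b₂ ∈ ℬ j₂ →
    μ a₁ b₁ * μ a₂ b₂ = ((-1 : k) ^ (i₂ * j₁)) • μ (a₁ * a₂) (b₁ * b₂)

/-- The sign character `(-1)^x` of `ZMod 2`, valued in `ℤ`. -/
def paritySign (x : ZMod 2) : ℤ := if x = 0 then 1 else -1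

theorem neg_one_zpow_eq_paritySign {k : Type} [Field k] (n : ℤ) :
    (-1 : k) ^ n = ((paritySign (n : ZMod 2) : ℤ) : k) := by
  rcases Int.even_or_odd n with h | h
  · rw [h.neg_one_zpow, paritySign, if_pos ((ZMod.intCast_zmod_eq_zero_iff_dvd n 2).2
      (by exact_mod_cast h.two_dvd))]
    simp
  · rw [h.neg_one_zpow, paritySign, if_neg]
    · simp
    · intro h0
      have h2 := (ZMod.intCast_zmod_eq_zero_iff_dvd n 2).1 h0
      exact (Int.not_even_iff_odd.2 h) (even_iff_two_dvd.2 (by exact_mod_cast h2))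

namespace IsDGPoissonAlgebra

variable {k : Type} [Field k] {A : Type} [Ring A] [Algebra k A] {𝒜 : ℤ → Submodule k A}
  {dA : A →ₗ[k] A} {br : A →ₗ[k] A →ₗ[k] A} {p : ℤ}

theorem left_comm (h : IsDGPoissonAlgebra k A 𝒜 dA br p) {i j : ℤ} {a b : A} (c : A)
    (ha : a ∈ 𝒜 i) (hb : b ∈ 𝒜 j) :
    a * (b * c) = ((-1 : k) ^ (i * j)) • (b * (a * c)) := by
  rw [← mul_assoc, h.comm i j a b ha hb, smul_mul_assoc, mul_assoc]

theorem br_mul_left [SetLike.GradedMonoid 𝒜] (h : IsDGPoissonAlgebra k A 𝒜 dA br p) {i j l : ℤ}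
    {a b c : A} (ha : a ∈ 𝒜 i) (hb : b ∈ 𝒜 j) (hc : c ∈ 𝒜 l) :
    br (a * b) c = a * br b c + ((-1 : k) ^ (j * (l + p))) • (br a c * b) := by
  rw [h.antisymm _ _ _ _ (SetLike.mul_mem_graded ha hb) hc, h.poisson _ _ _ _ _ _ hc ha hb,
    h.antisymm _ _ _ _ hc ha, h.antisymm _ _ _ _ hc hb]
  simp only [neg_mul, mul_neg, smul_mul_assoc, mul_smul_comm, smul_add, smul_neg, smul_smul]
  match_scalars
  all_goals
    simp only [neg_one_zpow_eq_paritySign, Int.cast_add, Int.cast_mul]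
    generalize (i : ZMod 2) = x
    generalize (j : ZMod 2) = y
    generalize (l : ZMod 2) = z
    generalize (p : ZMod 2) = q
    rw [← sub_eq_zero]
    norm_cast
    refine (congrArg Int.cast ?_).trans Int.cast_zero
    revert x y z q
    decide

end IsDGPoissonAlgebra

namespace RealizesGradedTensor

variable {k : Type} [Field k] {M : Type} [AddCommGroup M] [Module k M]
  {N : Type} [AddCommGroup N] [Module k N] {W : Type} [AddCommGroup W] [Module k W]
  {𝒱M : ℤ → Submodule k M} {𝒱N : ℤ → Submodule k N} {𝒲 : ℤ → Submodule k W}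
  {μ : M →ₗ[k] N →ₗ[k] W}

theorem homogeneous_induction (h : RealizesGradedTensor k M N W 𝒱M 𝒱N 𝒲 μ) {n : ℤ}
    {P : W → Prop} (tensor : ∀ i j m n', i + j = n → m ∈ 𝒱M i → n' ∈ 𝒱N j → P (μ m n'))
    (zero : P 0) (add : ∀ x y, P x → P y → P (x + y)) (smul : ∀ (c : k) x, P x → P (c • x))
    {w : W} (hw : w ∈ 𝒲 n) : P w := by
  refine Submodule.span_induction (p := fun x _ => P x) ?_ zero (fun x y _ _ => add x y)
    (fun c x _ => smul c x) (h.span n hw)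
  rintro _ ⟨i, j, m, n', hij, hm, hn, rfl⟩
  exact tensor i j m n' hij hm hn

theorem linearMap_ext [DirectSum.Decomposition 𝒱M] [DirectSum.Decomposition 𝒱N]
    (h : RealizesGradedTensor k M N W 𝒱M 𝒱N 𝒲 μ) {X : Type} [AddCommGroup X] [Module k X]
    {f g : W →ₗ[k] X}
    (hfg : ∀ i j m n, m ∈ 𝒱M i → n ∈ 𝒱N j → f (μ m n) = g (μ m n)) : f = g := by
  have key : ∀ m n, f (μ m n) = g (μ m n) := by
    intro m n
    induction m using DirectSum.Decomposition.inductionOn 𝒱M with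
    | zero => simp
    | add x y hx hy => simp [hx, hy]
    | homogeneous m =>
      induction n using DirectSum.Decomposition.inductionOn 𝒱N with
      | zero => simp
      | add x y hx hy => simp [hx, hy]
      | homogeneous n => exact hfg _ _ _ _ m.2 n.2
  ext w
  obtain ⟨t, rfl⟩ := h.bij.2 w
  induction t with
  | zero => simp
  | tmul m n => simpa using key m n
  | add x y hx hy => simp [hx, hy]

/-- The map sending `μ m n`, for `m` and `n` homogeneous of degrees `i` and `j`, to its copy in
the summand of degree `i + j`. -/
def decomposeMap [DirectSum.Decomposition 𝒱M] [DirectSum.Decomposition 𝒱N]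
    (h : RealizesGradedTensor k M N W 𝒱M 𝒱N 𝒲 μ) : W →ₗ[k] DirectSum ℤ fun n => 𝒲 n :=
  TensorProduct.lift
    ((DirectSum.toModule k ℤ (N →ₗ[k] DirectSum ℤ fun n => 𝒲 n) fun i =>
      ((DirectSum.toModule k ℤ (𝒱M i →ₗ[k] DirectSum ℤ fun n => 𝒲 n) fun j =>
        LinearMap.mk₂ k
          (fun (n : 𝒱N j) (m : 𝒱M i) =>
            DirectSum.lof k ℤ (fun n => 𝒲 n) (i + j) ⟨μ m n, h.mem i j m n m.2 n.2⟩)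
          (fun x y m => by rw [← map_add]; congr 1; ext; simp)
          (fun c x m => by rw [← map_smul]; congr 1; ext; simp)
          (fun x m m' => by rw [← map_add]; congr 1; ext; simp)
          (fun c x m => by rw [← map_smul]; congr 1; ext; simp)) ∘ₗ
        (DirectSum.decomposeLinearEquiv 𝒱N).toLinearMap).flip) ∘ₗ
      (DirectSum.decomposeLinearEquiv 𝒱M).toLinearMap) ∘ₗ
  (LinearEquiv.ofBijective _ h.bij).symm.toLinearMap

theorem decomposeMap_apply [DirectSum.Decomposition 𝒱M] [DirectSum.Decomposition 𝒱N]
    (h : RealizesGradedTensor k M N W 𝒱M 𝒱N 𝒲 μ) {i j : ℤ} {m : M} {n : N}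
    (hm : m ∈ 𝒱M i) (hn : n ∈ 𝒱N j) :
    h.decomposeMap (μ m n) =
      DirectSum.lof k ℤ (fun n => 𝒲 n) (i + j) ⟨μ m n, h.mem i j m n hm hn⟩ := by
  have e : (LinearEquiv.ofBijective _ h.bij).symm (μ m n) = m ⊗ₜ[k] n := by
    rw [LinearEquiv.symm_apply_eq]; simp
  simp only [decomposeMap, LinearMap.comp_apply, LinearEquiv.coe_coe, e, TensorProduct.lift.tmul,
    DirectSum.decomposeLinearEquiv_apply, DirectSum.decompose_of_mem 𝒱M hm,
    ← DirectSum.lof_eq_of k, DirectSum.toModule_lof, LinearMap.flip_apply]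
  simp only [DirectSum.decompose_of_mem 𝒱N hn,
    ← DirectSum.lof_eq_of k, DirectSum.toModule_lof, LinearMap.mk₂_apply]

theorem nonempty_decomposition [DirectSum.Decomposition 𝒱M] [DirectSum.Decomposition 𝒱N]
    (h : RealizesGradedTensor k M N W 𝒱M 𝒱N 𝒲 μ) : Nonempty (DirectSum.Decomposition 𝒲) := by
  refine ⟨DirectSum.Decomposition.ofLinearMap 𝒲 h.decomposeMap ?_ ?_⟩
  · apply h.linearMap_ext
    intro i j m n hm hn
    simp [h.decomposeMap_apply hm hn]
  · ext n w : 2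
    obtain ⟨w, hw⟩ := w
    have key : ∀ hw : w ∈ 𝒲 n, h.decomposeMap w = DirectSum.lof k ℤ (fun n => 𝒲 n) n ⟨w, hw⟩ := by
      suffices ∃ hw : w ∈ 𝒲 n,
          h.decomposeMap w = DirectSum.lof k ℤ (fun n => 𝒲 n) n ⟨w, hw⟩ from fun _ => this.2
      refine h.homogeneous_induction (P := fun w => ∃ hw : w ∈ 𝒲 n,
        h.decomposeMap w = DirectSum.lof k ℤ (fun n => 𝒲 n) n ⟨w, hw⟩) ?_ ?_ ?_ ?_ hw
      · rintro i j m n' rfl hm hn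
        exact ⟨_, h.decomposeMap_apply hm hn⟩
      · exact ⟨zero_mem _, by rw [map_zero]; exact (map_zero _).symm⟩
      · rintro x y ⟨hx, ex⟩ ⟨hy, ey⟩
        exact ⟨add_mem hx hy, by rw [map_add, ex, ey, ← map_add]; rfl⟩
      · rintro c x ⟨hx, ex⟩
        exact ⟨Submodule.smul_mem _ c hx, by rw [map_smul, ex, ← map_smul]; rfl⟩
    simp [key hw]

end RealizesGradedTensor

section TensorProduct

variable {k : Type} [Field k] {A : Type} [Ring A] [Algebra k A] {𝒜 : ℤ → Submodule k A}
  {dA : A →ₗ[k] A} {brA : A →ₗ[k] A →ₗ[k] A}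
  {B : Type} [Ring B] [Algebra k B] {ℬ : ℤ → Submodule k B}
  {dB : B →ₗ[k] B} {brB : B →ₗ[k] B →ₗ[k] B} {p : ℤ}
  {C : Type} [Ring C] [Algebra k C] {𝒞 : ℤ → Submodule k C} {μ : A →ₗ[k] B →ₗ[k] C}
  {dC : C →ₗ[k] C} {brC : C →ₗ[k] C →ₗ[k] C}
  {i₁ j₁ i₂ j₂ i₃ j₃ : ℤ} {a₁ a₂ a₃ : A} {b₁ b₂ b₃ : B}

/-- The defining formula of the differential of a graded tensor product. -/
def IsTensorDifferential (𝒜 : ℤ → Submodule k A) (dA : A →ₗ[k] A) (ℬ : ℤ → Submodule k B)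
    (dB : B →ₗ[k] B) (μ : A →ₗ[k] B →ₗ[k] C) (dC : C →ₗ[k] C) : Prop :=
  ∀ (i j : ℤ) (a : A) (b : B), a ∈ 𝒜 i → b ∈ ℬ j →
    dC (μ a b) = μ (dA a) b + ((-1 : k) ^ i) • μ a (dB b)

/-- The defining formula of the Poisson bracket of a graded tensor product. -/
def IsTensorBracket (𝒜 : ℤ → Submodule k A) (brA : A →ₗ[k] A →ₗ[k] A) (ℬ : ℤ → Submodule k B)
    (brB : B →ₗ[k] B →ₗ[k] B) (p : ℤ) (μ : A →ₗ[k] B →ₗ[k] C)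
    (brC : C →ₗ[k] C →ₗ[k] C) : Prop :=
  ∀ (i₁ j₁ i₂ j₂ : ℤ) (a₁ a₂ : A) (b₁ b₂ : B),
    a₁ ∈ 𝒜 i₁ → b₁ ∈ ℬ j₁ → a₂ ∈ 𝒜 i₂ → b₂ ∈ ℬ j₂ →
    brC (μ a₁ b₁) (μ a₂ b₂) =
      ((-1 : k) ^ ((i₂ + p) * j₁)) • μ (brA a₁ a₂) (b₁ * b₂) +
      ((-1 : k) ^ ((j₁ + p) * i₂)) • μ (a₁ * a₂) (brB b₁ b₂)

theorem IsTensorDifferential.apply_apply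
    (hA : IsDGPoissonAlgebra k A 𝒜 dA brA p) (hB : IsDGPoissonAlgebra k B ℬ dB brB p)
    (hd : IsTensorDifferential 𝒜 dA ℬ dB μ dC) (ha₁ : a₁ ∈ 𝒜 i₁) (hb₁ : b₁ ∈ ℬ j₁) :
    dC (dC (μ a₁ b₁)) = 0 := by
  rw [hd _ _ _ _ ha₁ hb₁, map_add, map_smul, hd _ _ _ _ (hA.d_mem _ _ ha₁) hb₁,
    hd _ _ _ _ ha₁ (hB.d_mem _ _ hb₁), hA.d_sq, hB.d_sq]
  simp [zpow_add₀]

theorem RealizesGradedTensorAlg.mul_comm_tmul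
    (hA : IsDGPoissonAlgebra k A 𝒜 dA brA p) (hB : IsDGPoissonAlgebra k B ℬ dB brB p)
    (hC : RealizesGradedTensorAlg k A B C 𝒜 ℬ 𝒞 μ)
    (ha₁ : a₁ ∈ 𝒜 i₁) (hb₁ : b₁ ∈ ℬ j₁) (ha₂ : a₂ ∈ 𝒜 i₂) (hb₂ : b₂ ∈ ℬ j₂) :
    μ a₁ b₁ * μ a₂ b₂ =
      ((-1 : k) ^ ((i₁ + j₁) * (i₂ + j₂))) • (μ a₂ b₂ * μ a₁ b₁) := by
  rw [hC.mul _ _ _ _ _ _ _ _ ha₁ hb₁ ha₂ hb₂, hC.mul _ _ _ _ _ _ _ _ ha₂ hb₂ ha₁ hb₁,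
    hA.comm _ _ _ _ ha₁ ha₂, hB.comm _ _ _ _ hb₁ hb₂]
  simp only [map_smul, LinearMap.smul_apply, smul_smul]
  match_scalars
  all_goals
    simp only [neg_one_zpow_eq_paritySign, Int.cast_add, Int.cast_mul]
    generalize (i₁ : ZMod 2) = x₁
    generalize (i₂ : ZMod 2) = x₂
    generalize (j₁ : ZMod 2) = y₁
    generalize (j₂ : ZMod 2) = y₂
    rw [← sub_eq_zero]
    norm_cast
    refine (congrArg Int.cast ?_).trans Int.cast_zero
    revert x₁ x₂ y₁ y₂
    decide

theorem IsTensorDifferential.apply_mul [SetLike.GradedMonoid 𝒜] [SetLike.GradedMonoid ℬ]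
    (hA : IsDGPoissonAlgebra k A 𝒜 dA brA p) (hB : IsDGPoissonAlgebra k B ℬ dB brB p)
    (hC : RealizesGradedTensorAlg k A B C 𝒜 ℬ 𝒞 μ)
    (hd : IsTensorDifferential 𝒜 dA ℬ dB μ dC)
    (ha₁ : a₁ ∈ 𝒜 i₁) (hb₁ : b₁ ∈ ℬ j₁) (ha₂ : a₂ ∈ 𝒜 i₂) (hb₂ : b₂ ∈ ℬ j₂) :
    dC (μ a₁ b₁ * μ a₂ b₂) =
      dC (μ a₁ b₁) * μ a₂ b₂ + ((-1 : k) ^ (i₁ + j₁)) • (μ a₁ b₁ * dC (μ a₂ b₂)) := by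
  simp only [hC.mul _ _ _ _ _ _ _ _ ha₁ hb₁ ha₂ hb₂, map_smul, hd _ _ _ _ ha₁ hb₁,
    hd _ _ _ _ ha₂ hb₂,
    hd _ _ _ _ (SetLike.mul_mem_graded ha₁ ha₂) (SetLike.mul_mem_graded hb₁ hb₂),
    hA.d_mul _ _ _ _ ha₁ ha₂, hB.d_mul _ _ _ _ hb₁ hb₂, add_mul, mul_add,
    smul_mul_assoc, mul_smul_comm,
    hC.mul _ _ _ _ _ _ _ _ (hA.d_mem _ _ ha₁) hb₁ ha₂ hb₂,
    hC.mul _ _ _ _ _ _ _ _ ha₁ (hB.d_mem _ _ hb₁) ha₂ hb₂,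
    hC.mul _ _ _ _ _ _ _ _ ha₁ hb₁ (hA.d_mem _ _ ha₂) hb₂,
    hC.mul _ _ _ _ _ _ _ _ ha₁ hb₁ ha₂ (hB.d_mem _ _ hb₂),
    map_add, LinearMap.add_apply, LinearMap.smul_apply]
  match_scalars
  all_goals simp only [neg_one_zpow_eq_paritySign, Int.cast_add, Int.cast_mul, Int.cast_one]
  all_goals
    generalize (i₁ : ZMod 2) = x₁
    generalize (i₂ : ZMod 2) = x₂
    generalize (j₁ : ZMod 2) = y₁
    generalize (j₂ : ZMod 2) = y₂
    rw [← sub_eq_zero]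
    norm_cast
    refine (congrArg Int.cast ?_).trans Int.cast_zero
    revert x₁ x₂ y₁ y₂
    decide

namespace IsTensorBracket

theorem antisymm
    (hA : IsDGPoissonAlgebra k A 𝒜 dA brA p) (hB : IsDGPoissonAlgebra k B ℬ dB brB p)
    (hbr : IsTensorBracket 𝒜 brA ℬ brB p μ brC)
    (ha₁ : a₁ ∈ 𝒜 i₁) (hb₁ : b₁ ∈ ℬ j₁) (ha₂ : a₂ ∈ 𝒜 i₂) (hb₂ : b₂ ∈ ℬ j₂) :
    brC (μ a₁ b₁) (μ a₂ b₂) =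
      -(((-1 : k) ^ ((i₁ + j₁ + p) * (i₂ + j₂ + p))) • brC (μ a₂ b₂) (μ a₁ b₁)) := by
  rw [hbr _ _ _ _ _ _ _ _ ha₁ hb₁ ha₂ hb₂, hbr _ _ _ _ _ _ _ _ ha₂ hb₂ ha₁ hb₁,
    hA.comm _ _ _ _ ha₁ ha₂, hB.comm _ _ _ _ hb₁ hb₂, hA.antisymm _ _ _ _ ha₁ ha₂,
    hB.antisymm _ _ _ _ hb₁ hb₂]
  simp only [map_smul, map_neg, LinearMap.smul_apply, LinearMap.neg_apply]
  match_scalars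
  all_goals
    simp only [neg_one_zpow_eq_paritySign, Int.cast_add, Int.cast_mul]
    generalize (i₁ : ZMod 2) = x₁
    generalize (i₂ : ZMod 2) = x₂
    generalize (j₁ : ZMod 2) = y₁
    generalize (j₂ : ZMod 2) = y₂
    generalize (p : ZMod 2) = q
    rw [← sub_eq_zero]
    norm_cast
    refine (congrArg Int.cast ?_).trans Int.cast_zero
    revert x₁ x₂ y₁ y₂ q
    decide

theorem differential_apply [SetLike.GradedMonoid 𝒜] [SetLike.GradedMonoid ℬ]
    (hA : IsDGPoissonAlgebra k A 𝒜 dA brA p) (hB : IsDGPoissonAlgebra k B ℬ dB brB p)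
    (hd : IsTensorDifferential 𝒜 dA ℬ dB μ dC) (hbr : IsTensorBracket 𝒜 brA ℬ brB p μ brC)
    (ha₁ : a₁ ∈ 𝒜 i₁) (hb₁ : b₁ ∈ ℬ j₁) (ha₂ : a₂ ∈ 𝒜 i₂) (hb₂ : b₂ ∈ ℬ j₂) :
    dC (brC (μ a₁ b₁) (μ a₂ b₂)) =
      brC (dC (μ a₁ b₁)) (μ a₂ b₂) +
        ((-1 : k) ^ (i₁ + j₁ + p)) • brC (μ a₁ b₁) (dC (μ a₂ b₂)) := by
  simp only [hbr _ _ _ _ _ _ _ _ ha₁ hb₁ ha₂ hb₂, map_smul, map_add, hd _ _ _ _ ha₁ hb₁,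
    hd _ _ _ _ ha₂ hb₂,
    hd _ _ _ _ (hA.br_mem _ _ _ _ ha₁ ha₂) (SetLike.mul_mem_graded hb₁ hb₂),
    hd _ _ _ _ (SetLike.mul_mem_graded ha₁ ha₂) (hB.br_mem _ _ _ _ hb₁ hb₂),
    hA.d_mul _ _ _ _ ha₁ ha₂, hB.d_mul _ _ _ _ hb₁ hb₂,
    hA.d_br _ _ _ _ ha₁ ha₂, hB.d_br _ _ _ _ hb₁ hb₂,
    hbr _ _ _ _ _ _ _ _ (hA.d_mem _ _ ha₁) hb₁ ha₂ hb₂,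
    hbr _ _ _ _ _ _ _ _ ha₁ (hB.d_mem _ _ hb₁) ha₂ hb₂,
    hbr _ _ _ _ _ _ _ _ ha₁ hb₁ (hA.d_mem _ _ ha₂) hb₂,
    hbr _ _ _ _ _ _ _ _ ha₁ hb₁ ha₂ (hB.d_mem _ _ hb₂),
    LinearMap.add_apply, LinearMap.smul_apply]
  match_scalars
  all_goals simp only [neg_one_zpow_eq_paritySign, Int.cast_add, Int.cast_mul, Int.cast_one]
  all_goals
    generalize (i₁ : ZMod 2) = x₁
    generalize (i₂ : ZMod 2) = x₂
    generalize (j₁ : ZMod 2) = y₁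
    generalize (j₂ : ZMod 2) = y₂
    generalize (p : ZMod 2) = q
    rw [← sub_eq_zero]
    norm_cast
    refine (congrArg Int.cast ?_).trans Int.cast_zero
    revert x₁ x₂ y₁ y₂ q
    decide

theorem poisson [SetLike.GradedMonoid 𝒜] [SetLike.GradedMonoid ℬ]
    (hA : IsDGPoissonAlgebra k A 𝒜 dA brA p) (hB : IsDGPoissonAlgebra k B ℬ dB brB p)
    (hC : RealizesGradedTensorAlg k A B C 𝒜 ℬ 𝒞 μ)
    (hbr : IsTensorBracket 𝒜 brA ℬ brB p μ brC)
    (ha₁ : a₁ ∈ 𝒜 i₁) (hb₁ : b₁ ∈ ℬ j₁) (ha₂ : a₂ ∈ 𝒜 i₂) (hb₂ : b₂ ∈ ℬ j₂)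
    (ha₃ : a₃ ∈ 𝒜 i₃) (hb₃ : b₃ ∈ ℬ j₃) :
    brC (μ a₁ b₁) (μ a₂ b₂ * μ a₃ b₃) =
      brC (μ a₁ b₁) (μ a₂ b₂) * μ a₃ b₃ +
        ((-1 : k) ^ ((i₁ + j₁ + p) * (i₂ + j₂))) • (μ a₂ b₂ * brC (μ a₁ b₁) (μ a₃ b₃)) := by
  simp only [hC.mul _ _ _ _ _ _ _ _ ha₂ hb₂ ha₃ hb₃, map_smul,
    hbr _ _ _ _ _ _ _ _ ha₁ hb₁ ha₂ hb₂, hbr _ _ _ _ _ _ _ _ ha₁ hb₁ ha₃ hb₃,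
    hbr _ _ _ _ _ _ _ _ ha₁ hb₁ (SetLike.mul_mem_graded ha₂ ha₃)
      (SetLike.mul_mem_graded hb₂ hb₃),
    hA.poisson _ _ _ _ _ _ ha₁ ha₂ ha₃, hB.poisson _ _ _ _ _ _ hb₁ hb₂ hb₃,
    add_mul, mul_add, smul_mul_assoc, mul_smul_comm,
    hC.mul _ _ _ _ _ _ _ _ (hA.br_mem _ _ _ _ ha₁ ha₂) (SetLike.mul_mem_graded hb₁ hb₂) ha₃ hb₃,
    hC.mul _ _ _ _ _ _ _ _ (SetLike.mul_mem_graded ha₁ ha₂) (hB.br_mem _ _ _ _ hb₁ hb₂) ha₃ hb₃,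
    hC.mul _ _ _ _ _ _ _ _ ha₂ hb₂ (hA.br_mem _ _ _ _ ha₁ ha₃) (SetLike.mul_mem_graded hb₁ hb₃),
    hC.mul _ _ _ _ _ _ _ _ ha₂ hb₂ (SetLike.mul_mem_graded ha₁ ha₃) (hB.br_mem _ _ _ _ hb₁ hb₃),
    mul_assoc, hA.left_comm a₃ ha₂ ha₁, hB.left_comm b₃ hb₂ hb₁,
    map_add, LinearMap.add_apply, LinearMap.smul_apply]
  match_scalars
  all_goals
    simp only [neg_one_zpow_eq_paritySign, Int.cast_add, Int.cast_mul]
    generalize (i₁ : ZMod 2) = x₁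
    generalize (i₂ : ZMod 2) = x₂
    generalize (i₃ : ZMod 2) = x₃
    generalize (j₁ : ZMod 2) = y₁
    generalize (j₂ : ZMod 2) = y₂
    generalize (j₃ : ZMod 2) = y₃
    generalize (p : ZMod 2) = q
    rw [← sub_eq_zero]
    norm_cast
    refine (congrArg Int.cast ?_).trans Int.cast_zero
    revert x₁ x₂ x₃ y₁ y₂ y₃ q
    decide +kernel

theorem jacobi [SetLike.GradedMonoid 𝒜] [SetLike.GradedMonoid ℬ]
    (hA : IsDGPoissonAlgebra k A 𝒜 dA brA p) (hB : IsDGPoissonAlgebra k B ℬ dB brB p)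
    (hbr : IsTensorBracket 𝒜 brA ℬ brB p μ brC)
    (ha₁ : a₁ ∈ 𝒜 i₁) (hb₁ : b₁ ∈ ℬ j₁) (ha₂ : a₂ ∈ 𝒜 i₂) (hb₂ : b₂ ∈ ℬ j₂)
    (ha₃ : a₃ ∈ 𝒜 i₃) (hb₃ : b₃ ∈ ℬ j₃) :
    brC (μ a₁ b₁) (brC (μ a₂ b₂) (μ a₃ b₃)) =
      brC (brC (μ a₁ b₁) (μ a₂ b₂)) (μ a₃ b₃) +
        ((-1 : k) ^ ((i₁ + j₁ + p) * (i₂ + j₂ + p))) •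
          brC (μ a₂ b₂) (brC (μ a₁ b₁) (μ a₃ b₃)) := by
  simp only [map_add, map_smul, LinearMap.add_apply, LinearMap.smul_apply,
    hbr _ _ _ _ _ _ _ _ ha₁ hb₁ ha₂ hb₂, hbr _ _ _ _ _ _ _ _ ha₁ hb₁ ha₃ hb₃,
    hbr _ _ _ _ _ _ _ _ ha₂ hb₂ ha₃ hb₃,
    hbr _ _ _ _ _ _ _ _ ha₁ hb₁ (hA.br_mem _ _ _ _ ha₂ ha₃) (SetLike.mul_mem_graded hb₂ hb₃),
    hbr _ _ _ _ _ _ _ _ ha₁ hb₁ (SetLike.mul_mem_graded ha₂ ha₃) (hB.br_mem _ _ _ _ hb₂ hb₃),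
    hbr _ _ _ _ _ _ _ _ ha₂ hb₂ (hA.br_mem _ _ _ _ ha₁ ha₃) (SetLike.mul_mem_graded hb₁ hb₃),
    hbr _ _ _ _ _ _ _ _ ha₂ hb₂ (SetLike.mul_mem_graded ha₁ ha₃) (hB.br_mem _ _ _ _ hb₁ hb₃),
    hbr _ _ _ _ _ _ _ _ (hA.br_mem _ _ _ _ ha₁ ha₂) (SetLike.mul_mem_graded hb₁ hb₂) ha₃ hb₃,
    hbr _ _ _ _ _ _ _ _ (SetLike.mul_mem_graded ha₁ ha₂) (hB.br_mem _ _ _ _ hb₁ hb₂) ha₃ hb₃,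
    hA.jacobi _ _ _ _ _ _ ha₁ ha₂ ha₃, hB.jacobi _ _ _ _ _ _ hb₁ hb₂ hb₃,
    hA.poisson _ _ _ _ _ _ ha₁ ha₂ ha₃, hB.poisson _ _ _ _ _ _ hb₁ hb₂ hb₃,
    hA.poisson _ _ _ _ _ _ ha₂ ha₁ ha₃, hB.poisson _ _ _ _ _ _ hb₂ hb₁ hb₃,
    hA.br_mul_left ha₁ ha₂ ha₃, hB.br_mul_left hb₁ hb₂ hb₃,
    hA.antisymm _ _ _ _ ha₂ ha₁, hB.antisymm _ _ _ _ hb₂ hb₁,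
    hA.comm _ _ _ _ (hA.br_mem _ _ _ _ ha₁ ha₃) ha₂,
    hB.comm _ _ _ _ (hB.br_mem _ _ _ _ hb₁ hb₃) hb₂,
    mul_assoc, hA.left_comm a₃ ha₂ ha₁, hB.left_comm b₃ hb₂ hb₁,
    neg_mul, smul_mul_assoc, map_neg, LinearMap.neg_apply]
  match_scalars
  all_goals
    simp only [neg_one_zpow_eq_paritySign, Int.cast_add, Int.cast_mul]
    generalize (i₁ : ZMod 2) = x₁
    generalize (i₂ : ZMod 2) = x₂
    generalize (i₃ : ZMod 2) = x₃
    generalize (j₁ : ZMod 2) = y₁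
    generalize (j₂ : ZMod 2) = y₂
    generalize (j₃ : ZMod 2) = y₃
    generalize (p : ZMod 2) = q
    rw [← sub_eq_zero]
    norm_cast
    refine (congrArg Int.cast ?_).trans Int.cast_zero
    revert x₁ x₂ x₃ y₁ y₂ y₃ q
    decide +kernel

end IsTensorBracket

end TensorProduct

/-- Let `A`, `B` be DG Poisson algebras with brackets of the same degree `p`.
The graded tensor product `A ⊗ B` (realized by an algebra `C` with bilinear map
`μ : a ⊗ b`, Koszul multiplication), with differential
`d(a ⊗ b) = dA a ⊗ b + (-1)^{|a|} a ⊗ dB b` and bracket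
`{a₁⊗b₁, a₂⊗b₂} = (-1)^{(|a₂|+p)|b₁|} {a₁,a₂} ⊗ b₁b₂ + (-1)^{(|b₁|+p)|a₂|} a₁a₂ ⊗ {b₁,b₂}`,
is a DG Poisson algebra with bracket of degree `p`. -/
theorem tensorProduct_isDGPoissonAlgebra
    (k : Type) [Field k]
    (A : Type) [Ring A] [Algebra k A]
    (𝒜 : ℤ → Submodule k A) [GradedAlgebra 𝒜] (dA : A →ₗ[k] A)
    (brA : A →ₗ[k] A →ₗ[k] A)
    (B : Type) [Ring B] [Algebra k B]
    (ℬ : ℤ → Submodule k B) [GradedAlgebra ℬ] (dB : B →ₗ[k] B)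
    (brB : B →ₗ[k] B →ₗ[k] B) (p : ℤ)
    (hA : IsDGPoissonAlgebra k A 𝒜 dA brA p)
    (hB : IsDGPoissonAlgebra k B ℬ dB brB p)
    -- `C` realizes the graded tensor product `A ⊗ B`
    (C : Type) [Ring C] [Algebra k C]
    (𝒞 : ℤ → Submodule k C) (μ : A →ₗ[k] B →ₗ[k] C)
    (hC : RealizesGradedTensorAlg k A B C 𝒜 ℬ 𝒞 μ)
    -- the differential of the graded tensor product
    (dC : C →ₗ[k] C)
    (hdC : ∀ (i j : ℤ) (a : A) (b : B), a ∈ 𝒜 i → b ∈ ℬ j →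
      dC (μ a b) = μ (dA a) b + ((-1 : k) ^ i) • μ a (dB b))
    -- the Poisson bracket of the graded tensor product
    (brC : C →ₗ[k] C →ₗ[k] C)
    (hbrC : ∀ (i₁ j₁ i₂ j₂ : ℤ) (a₁ a₂ : A) (b₁ b₂ : B),
      a₁ ∈ 𝒜 i₁ → b₁ ∈ ℬ j₁ → a₂ ∈ 𝒜 i₂ → b₂ ∈ ℬ j₂ →
      brC (μ a₁ b₁) (μ a₂ b₂) =
        ((-1 : k) ^ ((i₂ + p) * j₁)) • μ (brA a₁ a₂) (b₁ * b₂) +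
        ((-1 : k) ^ ((j₁ + p) * i₂)) • μ (a₁ * a₂) (brB b₁ b₂)) :
    SetLike.GradedMonoid 𝒞 ∧ Nonempty (DirectSum.Decomposition 𝒞) ∧
    IsDGPoissonAlgebra k C 𝒞 dC brC p := by
  have hd : IsTensorDifferential 𝒜 dA ℬ dB μ dC := hdC
  have hbr : IsTensorBracket 𝒜 brA ℬ brB p μ brC := hbrC
  have hT := hC.toRealizesGradedTensor
  refine ⟨{ one_mem := ?_, mul_mem := ?_ }, hT.nonempty_decomposition, ?_⟩
  · rw [← hC.one]
    exact hT.mem 0 0 1 1 SetLike.GradedOne.one_mem SetLike.GradedOne.one_mem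
  · intro m n x y hx hy
    refine hT.homogeneous_induction (P := fun x => x * y ∈ 𝒞 (m + n)) ?_ (by simp)
      (fun x x' h h' => by rw [add_mul]; exact add_mem h h')
      (fun c x h => by rw [smul_mul_assoc]; exact Submodule.smul_mem _ c h) hx
    rintro i₁ j₁ a₁ b₁ rfl ha₁ hb₁
    refine hT.homogeneous_induction (P := fun y => μ a₁ b₁ * y ∈ 𝒞 (i₁ + j₁ + n)) ?_ (by simp)
      (fun x x' h h' => by rw [mul_add]; exact add_mem h h')
      (fun c x h => by rw [mul_smul_comm]; exact Submodule.smul_mem _ c h) hy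
    rintro i₂ j₂ a₂ b₂ rfl ha₂ hb₂
    rw [hC.mul _ _ _ _ _ _ _ _ ha₁ hb₁ ha₂ hb₂, add_add_add_comm]
    exact Submodule.smul_mem _ _
      (hT.mem _ _ _ _ (SetLike.mul_mem_graded ha₁ ha₂) (SetLike.mul_mem_graded hb₁ hb₂))
  constructor
  · intro m n x y hx hy
    refine hT.homogeneous_induction (P := fun x => x * y = ((-1 : k) ^ (m * n)) • (y * x)) ?_
      (by simp) (fun x x' h h' => by rw [add_mul, mul_add, h, h', smul_add])
      (fun c x h => by rw [smul_mul_assoc, mul_smul_comm, h, smul_comm]) hx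
    rintro i₁ j₁ a₁ b₁ rfl ha₁ hb₁
    refine hT.homogeneous_induction
      (P := fun y => μ a₁ b₁ * y = ((-1 : k) ^ ((i₁ + j₁) * n)) • (y * μ a₁ b₁)) ?_
      (by simp) (fun x x' h h' => by rw [mul_add, add_mul x, h, h', smul_add])
      (fun c x h => by rw [smul_mul_assoc, mul_smul_comm, h, smul_comm]) hy
    rintro i₂ j₂ a₂ b₂ rfl ha₂ hb₂
    exact hC.mul_comm_tmul hA hB ha₁ hb₁ ha₂ hb₂
  · intro n x hx
    refine hT.homogeneous_induction (P := fun x => dC x ∈ 𝒞 (n + 1)) ?_ (by simp)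
      (fun x x' h h' => by rw [map_add]; exact add_mem h h')
      (fun c x h => by rw [map_smul]; exact Submodule.smul_mem _ c h) hx
    rintro i j a b rfl ha hb
    rw [hd _ _ _ _ ha hb]
    refine add_mem ?_ (Submodule.smul_mem _ _ ?_)
    · rw [add_right_comm]
      exact hT.mem _ _ _ _ (hA.d_mem _ _ ha) hb
    · rw [add_assoc]
      exact hT.mem _ _ _ _ ha (hB.d_mem _ _ hb)
  · have h0 : dC ∘ₗ dC = 0 := hT.linearMap_ext fun i j a b ha hb => hd.apply_apply hA hB ha hb
    exact LinearMap.congr_fun h0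
  · intro m n x y hx hy
    refine hT.homogeneous_induction
      (P := fun x => dC (x * y) = dC x * y + ((-1 : k) ^ m) • (x * dC y)) ?_ (by simp)
      (fun x x' h h' => by simp only [add_mul, map_add, h, h', smul_add]; abel)
      (fun c x h => by simp only [smul_mul_assoc, map_smul, h, smul_add, smul_comm c]) hx
    rintro i₁ j₁ a₁ b₁ rfl ha₁ hb₁
    refine hT.homogeneous_induction
      (P := fun y => dC (μ a₁ b₁ * y) =
        dC (μ a₁ b₁) * y + ((-1 : k) ^ (i₁ + j₁)) • (μ a₁ b₁ * dC y)) ?_ (by simp)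
      (fun x x' h h' => by simp only [mul_add, map_add, h, h', smul_add]; abel)
      (fun c x h => by simp only [mul_smul_comm, map_smul, h, smul_add, smul_comm c]) hy
    rintro i₂ j₂ a₂ b₂ rfl ha₂ hb₂
    exact hd.apply_mul hA hB hC ha₁ hb₁ ha₂ hb₂
  · intro m n x y hx hy
    refine hT.homogeneous_induction (P := fun x => brC x y ∈ 𝒞 (m + n + p)) ?_ (by simp)
      (fun x x' h h' => by rw [map_add]; exact add_mem h h')
      (fun c x h => by rw [map_smul]; exact Submodule.smul_mem _ c h) hx
    rintro i₁ j₁ a₁ b₁ rfl ha₁ hb₁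
    refine hT.homogeneous_induction (P := fun y => brC (μ a₁ b₁) y ∈ 𝒞 (i₁ + j₁ + n + p)) ?_
      (by simp) (fun x x' h h' => by rw [map_add]; exact add_mem h h')
      (fun c x h => by rw [map_smul]; exact Submodule.smul_mem _ c h) hy
    rintro i₂ j₂ a₂ b₂ rfl ha₂ hb₂
    rw [hbr _ _ _ _ _ _ _ _ ha₁ hb₁ ha₂ hb₂, add_add_add_comm]
    refine add_mem (Submodule.smul_mem _ _ ?_) (Submodule.smul_mem _ _ ?_)
    · rw [add_right_comm]
      exact hT.mem _ _ _ _ (hA.br_mem _ _ _ _ ha₁ ha₂) (SetLike.mul_mem_graded hb₁ hb₂)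
    · rw [add_assoc]
      exact hT.mem _ _ _ _ (SetLike.mul_mem_graded ha₁ ha₂) (hB.br_mem _ _ _ _ hb₁ hb₂)
  · intro m n x y hx hy
    refine hT.homogeneous_induction
      (P := fun x => brC x y = -(((-1 : k) ^ ((m + p) * (n + p))) • brC y x)) ?_ (by simp)
      (fun x x' h h' => by simp only [map_add, LinearMap.add_apply, h, h', smul_add, neg_add])
      (fun c x h => by
        simp only [map_smul, LinearMap.smul_apply, h, smul_neg, smul_comm c]) hx
    rintro i₁ j₁ a₁ b₁ rfl ha₁ hb₁
    refine hT.homogeneous_induction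
      (P := fun y => brC (μ a₁ b₁) y =
        -(((-1 : k) ^ ((i₁ + j₁ + p) * (n + p))) • brC y (μ a₁ b₁))) ?_ (by simp)
      (fun x x' h h' => by simp only [map_add, LinearMap.add_apply, h, h', smul_add, neg_add])
      (fun c x h => by
        simp only [map_smul, LinearMap.smul_apply, h, smul_neg, smul_comm c]) hy
    rintro i₂ j₂ a₂ b₂ rfl ha₂ hb₂
    exact hbr.antisymm hA hB ha₁ hb₁ ha₂ hb₂
  · intro m n l x y z hx hy hz
    refine hT.homogeneous_induction
      (P := fun x => brC x (brC y z) =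
        brC (brC x y) z + ((-1 : k) ^ ((m + p) * (n + p))) • brC y (brC x z)) ?_ (by simp)
      (fun x x' h h' => by simp only [map_add, LinearMap.add_apply, h, h', smul_add]; abel)
      (fun c x h => by
        simp only [map_smul, LinearMap.smul_apply, h, smul_add, smul_comm c]) hx
    rintro i₁ j₁ a₁ b₁ rfl ha₁ hb₁
    refine hT.homogeneous_induction
      (P := fun y => brC (μ a₁ b₁) (brC y z) = brC (brC (μ a₁ b₁) y) z +
        ((-1 : k) ^ ((i₁ + j₁ + p) * (n + p))) • brC y (brC (μ a₁ b₁) z)) ?_ (by simp)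
      (fun x x' h h' => by simp only [map_add, LinearMap.add_apply, h, h', smul_add]; abel)
      (fun c x h => by
        simp only [map_smul, LinearMap.smul_apply, h, smul_add, smul_comm c]) hy
    rintro i₂ j₂ a₂ b₂ rfl ha₂ hb₂
    refine hT.homogeneous_induction
      (P := fun z => brC (μ a₁ b₁) (brC (μ a₂ b₂) z) = brC (brC (μ a₁ b₁) (μ a₂ b₂)) z +
        ((-1 : k) ^ ((i₁ + j₁ + p) * (i₂ + j₂ + p))) •
          brC (μ a₂ b₂) (brC (μ a₁ b₁) z)) ?_ (by simp)
      (fun x x' h h' => by simp only [map_add, h, h', smul_add]; abel)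
      (fun c x h => by simp only [map_smul, h, smul_add, smul_comm c]) hz
    rintro i₃ j₃ a₃ b₃ rfl ha₃ hb₃
    exact hbr.jacobi hA hB ha₁ hb₁ ha₂ hb₂ ha₃ hb₃
  · intro m n x y hx hy
    refine hT.homogeneous_induction
      (P := fun x => dC (brC x y) = brC (dC x) y + ((-1 : k) ^ (m + p)) • brC x (dC y)) ?_
      (by simp)
      (fun x x' h h' => by simp only [map_add, LinearMap.add_apply, h, h', smul_add]; abel)
      (fun c x h => by
        simp only [map_smul, LinearMap.smul_apply, h, smul_add, smul_comm c]) hx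
    rintro i₁ j₁ a₁ b₁ rfl ha₁ hb₁
    refine hT.homogeneous_induction
      (P := fun y => dC (brC (μ a₁ b₁) y) =
        brC (dC (μ a₁ b₁)) y + ((-1 : k) ^ (i₁ + j₁ + p)) • brC (μ a₁ b₁) (dC y)) ?_ (by simp)
      (fun x x' h h' => by simp only [map_add, h, h', smul_add]; abel)
      (fun c x h => by simp only [map_smul, h, smul_add, smul_comm c]) hy
    rintro i₂ j₂ a₂ b₂ rfl ha₂ hb₂
    exact hbr.differential_apply hA hB hd ha₁ hb₁ ha₂ hb₂
  · intro m n l x y z hx hy hz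
    refine hT.homogeneous_induction
      (P := fun x => brC x (y * z) =
        brC x y * z + ((-1 : k) ^ ((m + p) * n)) • (y * brC x z)) ?_ (by simp)
      (fun x x' h h' => by
        simp only [map_add, LinearMap.add_apply, h, h', smul_add, add_mul, mul_add]; abel)
      (fun c x h => by
        simp only [map_smul, LinearMap.smul_apply, h, smul_add, smul_mul_assoc, mul_smul_comm,
          smul_comm c]) hx
    rintro i₁ j₁ a₁ b₁ rfl ha₁ hb₁
    refine hT.homogeneous_induction
      (P := fun y => brC (μ a₁ b₁) (y * z) = brC (μ a₁ b₁) y * z +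
        ((-1 : k) ^ ((i₁ + j₁ + p) * n)) • (y * brC (μ a₁ b₁) z)) ?_ (by simp)
      (fun x x' h h' => by simp only [map_add, h, h', smul_add, add_mul]; abel)
      (fun c x h => by
        simp only [map_smul, h, smul_add, smul_mul_assoc, smul_comm c]) hy
    rintro i₂ j₂ a₂ b₂ rfl ha₂ hb₂
    refine hT.homogeneous_induction
      (P := fun z => brC (μ a₁ b₁) (μ a₂ b₂ * z) = brC (μ a₁ b₁) (μ a₂ b₂) * z +
        ((-1 : k) ^ ((i₁ + j₁ + p) * (i₂ + j₂))) • (μ a₂ b₂ * brC (μ a₁ b₁) z)) ?_ (by simp)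
      (fun x x' h h' => by simp only [map_add, h, h', smul_add, mul_add]; abel)
      (fun c x h => by
        simp only [map_smul, h, smul_add, mul_smul_comm, smul_comm c]) hz
    rintro i₃ j₃ a₃ b₃ rfl ha₃ hb₃
    exact hbr.poisson hA hB hC ha₁ hb₁ ha₂ hb₂ ha₃ hb₃

end
end

section
/- Let A and B be DG Poisson algebras over a field k with Poisson brackets of the same degree p. Then there is an isomorphism of DG algebras (A ⊗ B)^{ue} ≅ A^{ue} ⊗ B^{ue}, where A ⊗ B carries the tensor product DG Poisson algebra structure and A^{ue} ⊗ B^{ue} is the graded tensor product of DG algebras. -/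
open scoped TensorProduct

noncomputable section

/-- Two integer powers of `-1` agree when the exponents have the same parity. -/
theorem neg_one_zpow_congr {k : Type} [Field k] {m n : ℤ} (h : Even m ↔ Even n) :
    (-1 : k) ^ m = (-1) ^ n := by
  rcases Int.even_or_odd m with hm | hm
  · rw [hm.neg_one_zpow, (h.1 hm).neg_one_zpow]
  · rw [hm.neg_one_zpow, Odd.neg_one_zpow]
    rw [← Int.not_even_iff_odd] at hm ⊢
    exact fun hn => hm (h.2 hn)

theorem neg_one_zpow_congr_zmod {k : Type} [Field k] {m n : ℤ} (h : (m : ZMod 2) = n) :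
    (-1 : k) ^ m = (-1) ^ n := by
  refine neg_one_zpow_congr ?_
  rw [← ZMod.intCast_eq_zero_iff_even, ← ZMod.intCast_eq_zero_iff_even, h]

theorem neg_one_zpow_smul_smul {k : Type} [Field k] {V : Type} [AddCommGroup V] [Module k V]
    (n : ℤ) (v : V) : (-1 : k) ^ n • (-1 : k) ^ n • v = v := by
  rw [smul_smul, neg_one_zpow_eq_ite]; split_ifs <;> simp

theorem eq_neg_one_zpow_smul {k : Type} [Field k] {V : Type} [AddCommGroup V] [Module k V]
    {n : ℤ} {v w : V} (h : v = (-1 : k) ^ n • w) : w = (-1 : k) ^ n • v := by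
  rw [h, neg_one_zpow_smul_smul]

/-- Linear maps that agree on all homogeneous elements are equal. -/
theorem LinearMap.ext_of_homogeneous {k : Type} [Field k]
    {V : Type} [AddCommGroup V] [Module k V] {W : Type} [AddCommGroup W] [Module k W]
    {𝒱 : ℤ → Submodule k V} (h𝒱 : ⨆ i, 𝒱 i = ⊤) {f g : V →ₗ[k] W}
    (h : ∀ i, ∀ v ∈ 𝒱 i, f v = g v) : f = g := by
  have : ⨆ i, 𝒱 i ≤ LinearMap.eqLocus f g := iSup_le fun i v hv => h i v hv
  ext v
  exact this (h𝒱 ▸ Submodule.mem_top)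

theorem iSup_eq_top_of_decomposition {k : Type} [Field k]
    {V : Type} [AddCommGroup V] [Module k V] (𝒱 : ℤ → Submodule k V)
    [DirectSum.Decomposition 𝒱] : ⨆ i, 𝒱 i = ⊤ :=
  (DirectSum.Decomposition.isInternal 𝒱).submodule_iSup_eq_top

/-- The linear map acting on the degree `i` part of a graded space by the sign `(-1) ^ (i * n)`. -/
def signTwist {k : Type} [Field k] {V : Type} [AddCommGroup V] [Module k V]
    (𝒱 : ℤ → Submodule k V) [DirectSum.Decomposition 𝒱] (n : ℤ) : V →ₗ[k] V :=
  (DirectSum.toModule k ℤ V fun i => (-1 : k) ^ (i * n) • (𝒱 i).subtype).comp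
    (DirectSum.decomposeLinearEquiv 𝒱).toLinearMap

theorem signTwist_of_mem {k : Type} [Field k] {V : Type} [AddCommGroup V] [Module k V]
    (𝒱 : ℤ → Submodule k V) [DirectSum.Decomposition 𝒱] (n : ℤ) {i : ℤ} {v : V}
    (hv : v ∈ 𝒱 i) : signTwist 𝒱 n v = (-1 : k) ^ (i * n) • v := by
  simp only [signTwist, LinearMap.comp_apply, LinearEquiv.coe_coe,
    DirectSum.decomposeLinearEquiv_apply, DirectSum.decompose_of_mem 𝒱 hv]
  rw [← DirectSum.lof_eq_of k, DirectSum.toModule_lof]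
  simp

/-- If homogeneous subspaces of the graded pieces already span everything, then they are the
graded pieces. -/
theorem le_of_iSup_eq_top {k : Type} [Field k] {V : Type} [AddCommGroup V] [Module k V]
    (𝒱 : ℤ → Submodule k V) [DirectSum.Decomposition 𝒱] {𝒮 : ℤ → Submodule k V}
    (hle : ∀ i, 𝒮 i ≤ 𝒱 i) (htop : ⨆ i, 𝒮 i = ⊤) (i : ℤ) : 𝒱 i ≤ 𝒮 i := by
  have key : ∀ v : V, ((DirectSum.decompose 𝒱 v i : 𝒱 i) : V) ∈ 𝒮 i := by
    intro v
    have hv : v ∈ ⨆ i, 𝒮 i := htop ▸ Submodule.mem_top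
    induction hv using Submodule.iSup_induction' with
    | mem j x hx =>
      by_cases hij : j = i
      · subst hij
        rwa [DirectSum.decompose_of_mem_same 𝒱 (hle _ hx)]
      · rw [DirectSum.decompose_of_mem_ne 𝒱 (hle _ hx) hij]
        exact zero_mem _
    | zero => simp
    | add x y _ _ hx hy =>
      rw [DirectSum.decompose_add]
      exact add_mem hx hy
  intro v hv
  simpa [DirectSum.decompose_of_mem_same 𝒱 hv] using key v

section GradedTensor

variable {k : Type} [Field k] {M : Type} [AddCommGroup M] [Module k M]
  {N : Type} [AddCommGroup N] [Module k N] {W : Type} [AddCommGroup W] [Module k W]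
  {𝒱M : ℤ → Submodule k M} {𝒱N : ℤ → Submodule k N} {𝒲 : ℤ → Submodule k W}
  {μ : M →ₗ[k] N →ₗ[k] W} {V : Type} [AddCommGroup V] [Module k V]

namespace RealizesGradedTensor

/-- The linear map out of a realized tensor product induced by a bilinear map. -/
def desc (h : RealizesGradedTensor k M N W 𝒱M 𝒱N 𝒲 μ) (f : M →ₗ[k] N →ₗ[k] V) : W →ₗ[k] V :=
  (TensorProduct.lift f).comp (LinearEquiv.ofBijective _ h.bij).symm.toLinearMap

theorem desc_apply (h : RealizesGradedTensor k M N W 𝒱M 𝒱N 𝒲 μ) (f : M →ₗ[k] N →ₗ[k] V)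
    (m : M) (n : N) : h.desc f (μ m n) = f m n := by
  have : (LinearEquiv.ofBijective _ h.bij).symm (μ m n) = m ⊗ₜ[k] n := by
    rw [LinearEquiv.symm_apply_eq]; simp
  simp [desc, this]

theorem hom_ext (h : RealizesGradedTensor k M N W 𝒱M 𝒱N 𝒲 μ) (hM : ⨆ i, 𝒱M i = ⊤)
    (hN : ⨆ i, 𝒱N i = ⊤) {f g : W →ₗ[k] V}
    (hfg : ∀ i j, ∀ m ∈ 𝒱M i, ∀ n ∈ 𝒱N j, f (μ m n) = g (μ m n)) : f = g := by
  have h1 : μ.compr₂ f = μ.compr₂ g :=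
    LinearMap.ext_of_homogeneous hM fun i m hm =>
      LinearMap.ext_of_homogeneous hN fun j n hn => hfg i j m hm n hn
  have h2 : f.comp (TensorProduct.lift μ) = g.comp (TensorProduct.lift μ) :=
    TensorProduct.ext' fun m n => by simpa using LinearMap.congr_fun₂ h1 m n
  ext w
  obtain ⟨t, rfl⟩ := h.bij.2 w
  exact LinearMap.congr_fun h2 t

theorem le_of_tensor_mem (h : RealizesGradedTensor k M N W 𝒱M 𝒱N 𝒲 μ) {l : ℤ}
    {S : Submodule k W}
    (hS : ∀ i j, i + j = l → ∀ m ∈ 𝒱M i, ∀ n ∈ 𝒱N j, μ m n ∈ S) : 𝒲 l ≤ S := by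
  intro w hw
  refine Submodule.span_le.2 ?_ (h.span l hw)
  rintro _ ⟨i, j, m, n, hij, hm, hn, rfl⟩
  exact hS i j hij m hm n hn

theorem eq_of_mem (h : RealizesGradedTensor k M N W 𝒱M 𝒱N 𝒲 μ) {l : ℤ} {f g : W →ₗ[k] V}
    (hfg : ∀ i j, i + j = l → ∀ m ∈ 𝒱M i, ∀ n ∈ 𝒱N j, f (μ m n) = g (μ m n))
    {w : W} (hw : w ∈ 𝒲 l) : f w = g w :=
  h.le_of_tensor_mem (S := LinearMap.eqLocus f g) hfg hw

theorem eq_of_mem₂ (h : RealizesGradedTensor k M N W 𝒱M 𝒱N 𝒲 μ) {l₁ l₂ : ℤ}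
    {f g : W →ₗ[k] W →ₗ[k] V}
    (hfg : ∀ i₁ j₁ i₂ j₂, i₁ + j₁ = l₁ → i₂ + j₂ = l₂ →
      ∀ m₁ ∈ 𝒱M i₁, ∀ n₁ ∈ 𝒱N j₁, ∀ m₂ ∈ 𝒱M i₂, ∀ n₂ ∈ 𝒱N j₂,
        f (μ m₁ n₁) (μ m₂ n₂) = g (μ m₁ n₁) (μ m₂ n₂))
    {w₁ w₂ : W} (hw₁ : w₁ ∈ 𝒲 l₁) (hw₂ : w₂ ∈ 𝒲 l₂) : f w₁ w₂ = g w₁ w₂ :=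
  h.eq_of_mem (f := f.flip w₂) (g := g.flip w₂) (fun i₁ j₁ h₁ m₁ hm₁ n₁ hn₁ =>
    h.eq_of_mem (fun i₂ j₂ h₂ m₂ hm₂ n₂ hn₂ =>
      hfg i₁ j₁ i₂ j₂ h₁ h₂ m₁ hm₁ n₁ hn₁ m₂ hm₂ n₂ hn₂) hw₂) hw₁

theorem iSup_eq_top (h : RealizesGradedTensor k M N W 𝒱M 𝒱N 𝒲 μ) (hM : ⨆ i, 𝒱M i = ⊤)
    (hN : ⨆ i, 𝒱N i = ⊤) : ⨆ i, 𝒲 i = ⊤ := by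
  have : (⨆ i, 𝒲 i).mkQ = 0 := h.hom_ext hM hN fun i j m hm n hn => by
    simpa using Submodule.mem_iSup_of_mem (i + j) (h.mem i j m n hm hn)
  simpa using congrArg LinearMap.ker this

end RealizesGradedTensor

end GradedTensor

section UniversalProperty

variable {k : Type} [Field k] {A : Type} [Ring A] [Algebra k A]

/-- A pair of linear maps `m, h : A → R` into an algebra satisfying the defining relations of the
universal enveloping algebra of the graded algebra `A` with bracket `br` of degree `p`. -/
structure IsUEPair (𝒜 : ℤ → Submodule k A) (br : A →ₗ[k] A →ₗ[k] A) (p : ℤ)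
    {R : Type} [Ring R] [Algebra k R] (m h : A →ₗ[k] R) : Prop where
  mul_m : ∀ (i j : ℤ) (a b : A), a ∈ 𝒜 i → b ∈ 𝒜 j → m (a * b) = m a * m b
  br_h : ∀ (i j : ℤ) (a b : A), a ∈ 𝒜 i → b ∈ 𝒜 j →
    h (br a b) = h a * h b - (-1 : k) ^ ((i + p) * (j + p)) • (h b * h a)
  mul_h : ∀ (i j : ℤ) (a b : A), a ∈ 𝒜 i → b ∈ 𝒜 j →
    h (a * b) = m a * h b + (-1 : k) ^ (i * j) • (m b * h a)
  br_m : ∀ (i j : ℤ) (a b : A), a ∈ 𝒜 i → b ∈ 𝒜 j →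
    m (br a b) = h a * m b - (-1 : k) ^ ((i + p) * j) • (m b * h a)
  one_m : m 1 = 1

variable {𝒜 : ℤ → Submodule k A} {br : A →ₗ[k] A →ₗ[k] A} {p : ℤ}
  {R : Type} [Ring R] [Algebra k R]

theorem isUEPair_ue : IsUEPair 𝒜 br p (ueM k A 𝒜 br p) (ueH k A 𝒜 br p) where
  mul_m i j a b ha hb := by
    simpa [ueM] using RingQuot.mkAlgHom_rel k (UERel.mul_M (br := br) (p := p) i j a b ha hb)
  br_h i j a b ha hb := by
    simpa [ueH] using RingQuot.mkAlgHom_rel k (UERel.br_H (br := br) (p := p) i j a b ha hb)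
  mul_h i j a b ha hb := by
    simpa [ueM, ueH] using RingQuot.mkAlgHom_rel k (UERel.mul_H (br := br) (p := p) i j a b ha hb)
  br_m i j a b ha hb := by
    simpa [ueM, ueH] using RingQuot.mkAlgHom_rel k (UERel.br_M (br := br) (p := p) i j a b ha hb)
  one_m := by
    simpa [ueM] using RingQuot.mkAlgHom_rel k (UERel.one_M (𝒜 := 𝒜) (br := br) (p := p))

namespace IsUEPair

variable {m h : A →ₗ[k] R}

theorem h_one (H : IsUEPair 𝒜 br p m h) (h1 : (1 : A) ∈ 𝒜 0) : h 1 = 0 := by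
  simpa [H.one_m] using H.mul_h 0 0 1 1 h1 h1

/-- The algebra map out of the universal enveloping algebra given by its universal property. -/
def lift (H : IsUEPair 𝒜 br p m h) : UEA k A 𝒜 br p →ₐ[k] R :=
  RingQuot.liftAlgHom k ⟨TensorAlgebra.lift k (m.coprod h), by
    rintro _ _ (⟨i, j, a, b, ha, hb⟩ | ⟨i, j, a, b, ha, hb⟩ | ⟨i, j, a, b, ha, hb⟩ |
      ⟨i, j, a, b, ha, hb⟩ | _)
    · simpa using H.mul_m i j a b ha hb
    · simpa using H.br_h i j a b ha hb
    · simpa using H.mul_h i j a b ha hb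
    · simpa using H.br_m i j a b ha hb
    · simpa using H.one_m⟩

theorem lift_ueM (H : IsUEPair 𝒜 br p m h) (a : A) : H.lift (ueM k A 𝒜 br p a) = m a := by
  simp [lift, ueM]

theorem lift_ueH (H : IsUEPair 𝒜 br p m h) (a : A) : H.lift (ueH k A 𝒜 br p a) = h a := by
  simp [lift, ueH]

/-- The defining relations pull back along morphisms of graded algebras with bracket. -/
theorem comp (H : IsUEPair 𝒜 br p m h) {A' : Type} [Ring A'] [Algebra k A']
    {𝒜' : ℤ → Submodule k A'} {br' : A' →ₗ[k] A' →ₗ[k] A'} (f : A' →ₗ[k] A)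
    (f_mem : ∀ i, ∀ a ∈ 𝒜' i, f a ∈ 𝒜 i) (f_one : f 1 = 1)
    (f_mul : ∀ i j, ∀ a ∈ 𝒜' i, ∀ b ∈ 𝒜' j, f (a * b) = f a * f b)
    (f_br : ∀ i j, ∀ a ∈ 𝒜' i, ∀ b ∈ 𝒜' j, f (br' a b) = br (f a) (f b)) :
    IsUEPair 𝒜' br' p (m.comp f) (h.comp f) where
  mul_m i j a b ha hb := by
    simpa [f_mul i j a ha b hb] using H.mul_m i j _ _ (f_mem i a ha) (f_mem j b hb)
  br_h i j a b ha hb := by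
    simpa [f_br i j a ha b hb] using H.br_h i j _ _ (f_mem i a ha) (f_mem j b hb)
  mul_h i j a b ha hb := by
    simpa [f_mul i j a ha b hb] using H.mul_h i j _ _ (f_mem i a ha) (f_mem j b hb)
  br_m i j a b ha hb := by
    simpa [f_br i j a ha b hb] using H.br_m i j _ _ (f_mem i a ha) (f_mem j b hb)
  one_m := by simp [f_one, H.one_m]

end IsUEPair

theorem UEA.algHom_ext {f g : UEA k A 𝒜 br p →ₐ[k] R}
    (hM : f.toLinearMap.comp (ueM k A 𝒜 br p) = g.toLinearMap.comp (ueM k A 𝒜 br p))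
    (hH : f.toLinearMap.comp (ueH k A 𝒜 br p) = g.toLinearMap.comp (ueH k A 𝒜 br p)) :
    f = g := by
  apply RingQuot.ringQuot_ext'
  apply TensorAlgebra.hom_ext
  apply LinearMap.prod_ext
  · exact hM
  · exact hH

/-- A subspace of the universal enveloping algebra that contains `1` and is stable under left
multiplication by the generators is everything. -/
theorem UEA.eq_top_of_mul_mem {S : Submodule k (UEA k A 𝒜 br p)} (one : 1 ∈ S)
    (hM : ∀ a, ∀ x ∈ S, ueM k A 𝒜 br p a * x ∈ S)
    (hH : ∀ a, ∀ x ∈ S, ueH k A 𝒜 br p a * x ∈ S) : S = ⊤ := by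
  have key : ∀ t : TensorAlgebra k (A × A), ∀ x ∈ S,
      RingQuot.mkAlgHom k (UERel k A 𝒜 br p) t * x ∈ S := by
    intro t
    induction t using TensorAlgebra.induction with
    | algebraMap r =>
      intro x hx
      simpa [← Algebra.smul_def] using S.smul_mem r hx
    | ι v =>
      intro x hx
      have : RingQuot.mkAlgHom k (UERel k A 𝒜 br p) (TensorAlgebra.ι k v) =
          ueM k A 𝒜 br p v.1 + ueH k A 𝒜 br p v.2 := by
        simp [ueM, ueH, ← map_add]
      rw [this, add_mul]
      exact S.add_mem (hM _ x hx) (hH _ x hx)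
    | mul s t hs ht =>
      intro x hx
      rw [map_mul, mul_assoc]
      exact hs _ (ht x hx)
    | add s t hs ht =>
      intro x hx
      rw [map_add, add_mul]
      exact S.add_mem (hs x hx) (ht x hx)
  rw [eq_top_iff]
  rintro x -
  obtain ⟨t, rfl⟩ := RingQuot.mkAlgHom_surjective k (UERel k A 𝒜 br p) x
  simpa using key t 1 one

namespace IsUEADG

variable {dA : A →ₗ[k] A} {ℬ : ℤ → Submodule k (UEA k A 𝒜 br p)}
  {D : UEA k A 𝒜 br p →ₗ[k] UEA k A 𝒜 br p}

/-- Induction principle for homogeneous elements of the universal enveloping algebra. -/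
theorem le_of_mul_mem (hD : IsUEADG k A 𝒜 dA br p ℬ D) (h𝒜 : ⨆ i, 𝒜 i = ⊤)
    {𝒮 : ℤ → Submodule k (UEA k A 𝒜 br p)} (one : 1 ∈ 𝒮 0)
    (hM : ∀ i j, ∀ a ∈ 𝒜 i, ∀ x ∈ ℬ j, x ∈ 𝒮 j → ueM k A 𝒜 br p a * x ∈ 𝒮 (i + j))
    (hH : ∀ i j, ∀ a ∈ 𝒜 i, ∀ x ∈ ℬ j, x ∈ 𝒮 j → ueH k A 𝒜 br p a * x ∈ 𝒮 (i + p + j))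
    (i : ℤ) : ℬ i ≤ 𝒮 i := by
  have := hD.dga.graded_monoid
  have := hD.dga.decomp.some
  suffices h : ⨆ i, (ℬ i ⊓ 𝒮 i) = ⊤ from
    (le_of_iSup_eq_top ℬ (𝒮 := fun i => ℬ i ⊓ 𝒮 i) (fun i => inf_le_left) h i).trans inf_le_right
  have key : ∀ (g : A →ₗ[k] UEA k A 𝒜 br p) (q : ℤ),
      (∀ i j, ∀ a ∈ 𝒜 i, ∀ x ∈ ℬ j, x ∈ 𝒮 j → g a * x ∈ ℬ (i + q + j) ⊓ 𝒮 (i + q + j)) →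
      ∀ a, ∀ x ∈ ⨆ i, (ℬ i ⊓ 𝒮 i), g a * x ∈ ⨆ i, (ℬ i ⊓ 𝒮 i) := by
    intro g q hg a x hx
    have ha : a ∈ ⨆ i, 𝒜 i := h𝒜 ▸ Submodule.mem_top
    induction ha using Submodule.iSup_induction' with
    | mem i a ha =>
      induction hx using Submodule.iSup_induction' with
      | mem j x hx => exact Submodule.mem_iSup_of_mem _ (hg i j a ha x hx.1 hx.2)
      | zero => simp
      | add x y _ _ hx hy =>
        rw [mul_add]
        exact add_mem hx hy
    | zero => simp
    | add a b _ _ ha hb =>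
      rw [map_add, add_mul]
      exact add_mem ha hb
  refine UEA.eq_top_of_mul_mem ?_ (key _ 0 ?_) (key _ p ?_)
  · exact Submodule.mem_iSup_of_mem 0 ⟨SetLike.GradedOne.one_mem, one⟩
  · intro i j a ha x hx hx'
    rw [add_zero]
    exact ⟨SetLike.GradedMul.mul_mem (hD.m_mem i a ha) hx, hM i j a ha x hx hx'⟩
  · intro i j a ha x hx hx'
    exact ⟨SetLike.GradedMul.mul_mem (hD.h_mem i a ha) hx, hH i j a ha x hx hx'⟩

theorem iSup_eq_top (hD : IsUEADG k A 𝒜 dA br p ℬ D) : ⨆ i, ℬ i = ⊤ :=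
  have := hD.dga.decomp.some
  iSup_eq_top_of_decomposition ℬ

/-- An element that graded-commutes with the images of the generators graded-commutes with the
image of the whole universal enveloping algebra. -/
theorem graded_commute (hD : IsUEADG k A 𝒜 dA br p ℬ D) (h𝒜 : ⨆ i, 𝒜 i = ⊤)
    (ψ : UEA k A 𝒜 br p →ₐ[k] R) {z : R} {n : ℤ}
    (hM : ∀ i, ∀ a ∈ 𝒜 i, z * ψ (ueM k A 𝒜 br p a) =
      (-1 : k) ^ (i * n) • (ψ (ueM k A 𝒜 br p a) * z))
    (hH : ∀ i, ∀ a ∈ 𝒜 i, z * ψ (ueH k A 𝒜 br p a) =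
      (-1 : k) ^ ((i + p) * n) • (ψ (ueH k A 𝒜 br p a) * z))
    {i : ℤ} {x : UEA k A 𝒜 br p} (hx : x ∈ ℬ i) :
    z * ψ x = (-1 : k) ^ (i * n) • (ψ x * z) := by
  have hne : (-1 : k) ≠ 0 := neg_ne_zero.2 one_ne_zero
  let 𝒮 : ℤ → Submodule k (UEA k A 𝒜 br p) := fun i =>
    LinearMap.eqLocus ((LinearMap.mulLeft k z).comp ψ.toLinearMap)
      ((-1 : k) ^ (i * n) • (LinearMap.mulRight k z).comp ψ.toLinearMap)
  have hS : ∀ i x, x ∈ 𝒮 i ↔ z * ψ x = (-1 : k) ^ (i * n) • (ψ x * z) := fun i x => Iff.rfl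
  have step : ∀ (g x : UEA k A 𝒜 br p) (i j : ℤ),
      z * ψ g = (-1 : k) ^ (i * n) • (ψ g * z) → x ∈ 𝒮 j → g * x ∈ 𝒮 (i + j) := by
    intro g x i j hg hx
    rw [hS] at hx ⊢
    rw [map_mul, ← mul_assoc, hg, smul_mul_assoc, mul_assoc, hx, mul_smul_comm, smul_smul,
      add_mul, zpow_add₀ hne, mul_assoc]
  refine (hS i x).1 (hD.le_of_mul_mem h𝒜 (𝒮 := 𝒮) ?_ ?_ ?_ i hx)
  · simp [hS]
  · exact fun i j a ha x _ hx => step _ x i j (hM i a ha) hx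
  · exact fun i j a ha x _ hx => step _ x (i + p) j (hH i a ha) hx

end IsUEADG

end UniversalProperty

section Bracket

variable {k : Type} [Field k] {A : Type} [Ring A] [Algebra k A] {𝒜 : ℤ → Submodule k A}
  {dA : A →ₗ[k] A} {br : A →ₗ[k] A →ₗ[k] A} {p : ℤ}

namespace IsDGPoissonAlgebra

theorem br_one (hA : IsDGPoissonAlgebra k A 𝒜 dA br p) (h1 : (1 : A) ∈ 𝒜 0) {i : ℤ} {a : A}
    (ha : a ∈ 𝒜 i) : br a 1 = 0 := by
  simpa using hA.poisson i 0 0 a 1 1 ha h1 h1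

theorem one_br (hA : IsDGPoissonAlgebra k A 𝒜 dA br p) (h1 : (1 : A) ∈ 𝒜 0) {i : ℤ} {a : A}
    (ha : a ∈ 𝒜 i) : br 1 a = 0 := by
  simp [hA.antisymm 0 i 1 a h1 ha, hA.br_one h1 ha]

end IsDGPoissonAlgebra

namespace IsUEPair

variable {R : Type} [Ring R] [Algebra k R] {m h : A →ₗ[k] R}

theorem m_mul_m_comm (H : IsUEPair 𝒜 br p m h) (hA : IsDGPoissonAlgebra k A 𝒜 dA br p)
    {i j : ℤ} {a b : A} (ha : a ∈ 𝒜 i) (hb : b ∈ 𝒜 j) :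
    m b * m a = (-1 : k) ^ (i * j) • m (a * b) := by
  rw [← H.mul_m j i b a hb ha, hA.comm j i b a hb ha, map_smul, mul_comm]

theorem h_mul_m (H : IsUEPair 𝒜 br p m h) {i j : ℤ} {a b : A} (ha : a ∈ 𝒜 i) (hb : b ∈ 𝒜 j) :
    h a * m b = m (br a b) + (-1 : k) ^ ((i + p) * j) • (m b * h a) := by
  rw [H.br_m i j a b ha hb, sub_add_cancel]

theorem h_mul_m_comm (H : IsUEPair 𝒜 br p m h) (hA : IsDGPoissonAlgebra k A 𝒜 dA br p)
    {i j : ℤ} {a b : A} (ha : a ∈ 𝒜 i) (hb : b ∈ 𝒜 j) :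
    h b * m a = -((-1 : k) ^ ((i + p) * (j + p)) • m (br a b)) +
      (-1 : k) ^ ((j + p) * i) • (m a * h b) := by
  rw [H.h_mul_m hb ha, hA.antisymm j i b a hb ha, map_neg, map_smul, mul_comm]

theorem h_mul_h (H : IsUEPair 𝒜 br p m h) {i j : ℤ} {a b : A} (ha : a ∈ 𝒜 i) (hb : b ∈ 𝒜 j) :
    h a * h b = h (br a b) + (-1 : k) ^ ((i + p) * (j + p)) • (h b * h a) := by
  rw [H.br_h i j a b ha hb, sub_add_cancel]

end IsUEPair

end Bracket

section GradedTensorAlg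

variable {k : Type} [Field k] {A : Type} [Ring A] [Algebra k A] {B : Type} [Ring B] [Algebra k B]
  {C : Type} [Ring C] [Algebra k C] {𝒜 : ℤ → Submodule k A} {ℬ : ℤ → Submodule k B}
  {𝒞 : ℤ → Submodule k C} {μ : A →ₗ[k] B →ₗ[k] C}

namespace RealizesGradedTensorAlg

theorem mul_mem (h : RealizesGradedTensorAlg k A B C 𝒜 ℬ 𝒞 μ)
    (hA : SetLike.GradedMonoid 𝒜) (hB : SetLike.GradedMonoid ℬ) {i j : ℤ} {x y : C}
    (hx : x ∈ 𝒞 i) (hy : y ∈ 𝒞 j) : x * y ∈ 𝒞 (i + j) := by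
  have hT := h.toRealizesGradedTensor
  refine hT.le_of_tensor_mem (S := (𝒞 (i + j)).comap (LinearMap.mulRight k y)) ?_ hx
  rintro i₁ j₁ rfl a₁ ha₁ b₁ hb₁
  refine hT.le_of_tensor_mem
    (S := (𝒞 (i₁ + j₁ + j)).comap (LinearMap.mulLeft k (μ a₁ b₁))) ?_ hy
  rintro i₂ j₂ rfl a₂ ha₂ b₂ hb₂
  rw [Submodule.mem_comap, LinearMap.mulLeft_apply, h.mul i₁ j₁ i₂ j₂ _ _ _ _ ha₁ hb₁ ha₂ hb₂,
    add_add_add_comm]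
  exact Submodule.smul_mem _ _ (hT.mem _ _ _ _ (hA.mul_mem ha₁ ha₂) (hB.mul_mem hb₁ hb₂))

theorem one_mem (h : RealizesGradedTensorAlg k A B C 𝒜 ℬ 𝒞 μ)
    (hA : SetLike.GradedMonoid 𝒜) (hB : SetLike.GradedMonoid ℬ) : 1 ∈ 𝒞 0 := by
  rw [← h.one]
  exact h.toRealizesGradedTensor.mem 0 0 1 1 hA.one_mem hB.one_mem

/-- The inclusion `a ↦ a ⊗ 1` of the left factor. -/
def inl (h : RealizesGradedTensorAlg k A B C 𝒜 ℬ 𝒞 μ) (hB1 : (1 : B) ∈ ℬ 0)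
    (hA : ⨆ i, 𝒜 i = ⊤) : A →ₐ[k] C :=
  AlgHom.ofLinearMap (μ.flip 1) h.one <| by
    have : (LinearMap.mul k A).compr₂ (μ.flip 1) =
        (LinearMap.mul k C).compl₁₂ (μ.flip 1) (μ.flip 1) :=
      LinearMap.ext_of_homogeneous hA fun i a ha =>
        LinearMap.ext_of_homogeneous hA fun j b hb => by
          simp [h.mul i 0 j 0 a b 1 1 ha hB1 hb hB1]
    exact fun a b => LinearMap.congr_fun₂ this a b

/-- The inclusion `b ↦ 1 ⊗ b` of the right factor. -/
def inr (h : RealizesGradedTensorAlg k A B C 𝒜 ℬ 𝒞 μ) (hA1 : (1 : A) ∈ 𝒜 0)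
    (hB : ⨆ i, ℬ i = ⊤) : B →ₐ[k] C :=
  AlgHom.ofLinearMap (μ 1) h.one <| by
    have : (LinearMap.mul k B).compr₂ (μ 1) = (LinearMap.mul k C).compl₁₂ (μ 1) (μ 1) :=
      LinearMap.ext_of_homogeneous hB fun i a ha =>
        LinearMap.ext_of_homogeneous hB fun j b hb => by
          simp [h.mul 0 i 0 j 1 1 a b hA1 ha hA1 hb]
    exact fun a b => LinearMap.congr_fun₂ this a b

/-- A pair of algebra maps whose values graded-commute induces an algebra map out of the graded
tensor product. -/
theorem exists_algHom (h : RealizesGradedTensorAlg k A B C 𝒜 ℬ 𝒞 μ) (hA : ⨆ i, 𝒜 i = ⊤)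
    (hB : ⨆ i, ℬ i = ⊤) {R : Type} [Ring R] [Algebra k R] (f : A →ₐ[k] R) (g : B →ₐ[k] R)
    (hfg : ∀ i j, ∀ a ∈ 𝒜 i, ∀ b ∈ ℬ j, g b * f a = (-1 : k) ^ (i * j) • (f a * g b)) :
    ∃ φ : C →ₐ[k] R, ∀ a b, φ (μ a b) = f a * g b := by
  have hT := h.toRealizesGradedTensor
  let φ : C →ₗ[k] R := hT.desc ((LinearMap.mul k R).compl₁₂ f.toLinearMap g.toLinearMap)
  have hφ : ∀ a b, φ (μ a b) = f a * g b := fun a b => by simp [φ, hT.desc_apply]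
  have hmul : (LinearMap.mul k C).compr₂ φ = (LinearMap.mul k R).compl₁₂ φ φ :=
    hT.hom_ext hA hB fun i₁ j₁ a₁ ha₁ b₁ hb₁ => hT.hom_ext hA hB fun i₂ j₂ a₂ ha₂ b₂ hb₂ => by
      have key : f a₁ * g b₁ * (f a₂ * g b₂) = f a₁ * (g b₁ * f a₂) * g b₂ := by
        simp only [mul_assoc]
      simp only [LinearMap.compr₂_apply, LinearMap.mul_apply', LinearMap.compl₁₂_apply, hφ,
        h.mul i₁ j₁ i₂ j₂ a₁ a₂ b₁ b₂ ha₁ hb₁ ha₂ hb₂, map_smul, map_mul, key,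
        hfg i₂ j₁ a₂ ha₂ b₁ hb₁, mul_smul_comm, smul_mul_assoc]
      simp only [mul_assoc]
  refine ⟨AlgHom.ofLinearMap φ ?_ fun x y => LinearMap.congr_fun₂ hmul x y, hφ⟩
  rw [← h.one, hφ, map_one, map_one, mul_one]

/-- The Koszul-signed differential of a graded tensor product of DG algebras is a graded
derivation. -/
theorem d_mul (h : RealizesGradedTensorAlg k A B C 𝒜 ℬ 𝒞 μ) {DA : A →ₗ[k] A} {DB : B →ₗ[k] B}
    {dC : C →ₗ[k] C} (hA : IsDGAlgebra k A 𝒜 DA) (hB : IsDGAlgebra k B ℬ DB)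
    (hd : ∀ i j, ∀ a ∈ 𝒜 i, ∀ b ∈ ℬ j,
      dC (μ a b) = μ (DA a) b + (-1 : k) ^ i • μ a (DB b))
    {i j : ℤ} {x y : C} (hx : x ∈ 𝒞 i) (hy : y ∈ 𝒞 j) :
    dC (x * y) = dC x * y + (-1 : k) ^ i • (x * dC y) := by
  have hT := h.toRealizesGradedTensor
  have := hA.graded_monoid
  have := hB.graded_monoid
  refine hT.eq_of_mem₂ (f := (LinearMap.mul k C).compr₂ dC)
    (g := (LinearMap.mul k C).comp dC + (-1 : k) ^ i • (LinearMap.mul k C).compl₂ dC) ?_ hx hy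
  rintro i₁ j₁ i₂ j₂ rfl rfl a₁ ha₁ b₁ hb₁ a₂ ha₂ b₂ hb₂
  have haa := SetLike.GradedMul.mul_mem ha₁ ha₂
  have hbb := SetLike.GradedMul.mul_mem hb₁ hb₂
  have hda₁ := hA.d_mem _ _ ha₁
  have hda₂ := hA.d_mem _ _ ha₂
  have hdb₁ := hB.d_mem _ _ hb₁
  have hdb₂ := hB.d_mem _ _ hb₂
  simp only [LinearMap.compr₂_apply, LinearMap.mul_apply', LinearMap.add_apply,
    LinearMap.comp_apply, LinearMap.smul_apply, LinearMap.compl₂_apply,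
    h.mul i₁ j₁ i₂ j₂ _ _ _ _ ha₁ hb₁ ha₂ hb₂, map_smul,
    hd _ _ _ haa _ hbb, hd _ _ _ ha₁ _ hb₁, hd _ _ _ ha₂ _ hb₂, add_mul, mul_add,
    hA.d_mul _ _ _ _ ha₁ ha₂, hB.d_mul _ _ _ _ hb₁ hb₂,
    h.mul _ _ _ _ _ _ _ _ hda₁ hb₁ ha₂ hb₂, h.mul _ _ _ _ _ _ _ _ ha₁ hdb₁ ha₂ hb₂,
    h.mul _ _ _ _ _ _ _ _ ha₁ hb₁ hda₂ hb₂, h.mul _ _ _ _ _ _ _ _ ha₁ hb₁ ha₂ hdb₂,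
    map_add, LinearMap.add_apply, map_smul, LinearMap.smul_apply]
  have hne : (-1 : k) ≠ 0 := neg_ne_zero.2 one_ne_zero
  match_scalars <;>
    simp only [mul_one, ← zpow_add₀ hne] <;>
    refine neg_one_zpow_congr ?_ <;> simp only [Int.even_add, Int.even_mul] <;> grind

end RealizesGradedTensorAlg

end GradedTensorAlg

section TensorPair

variable {k : Type} [Field k]
  {A : Type} [Ring A] [Algebra k A] {𝒜 : ℤ → Submodule k A} {dA : A →ₗ[k] A}
  {brA : A →ₗ[k] A →ₗ[k] A}
  {B : Type} [Ring B] [Algebra k B] {ℬ : ℤ → Submodule k B} {dB : B →ₗ[k] B}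
  {brB : B →ₗ[k] B →ₗ[k] B} {p : ℤ}
  {U : Type} [Ring U] [Algebra k U] {𝒰 : ℤ → Submodule k U} {mA hA : A →ₗ[k] U}
  {V : Type} [Ring V] [Algebra k V] {𝒱 : ℤ → Submodule k V} {mB hB : B →ₗ[k] V}
  {E : Type} [Ring E] [Algebra k E] {ℰ : ℤ → Submodule k E} {ν : U →ₗ[k] V →ₗ[k] E}
  {T : Type} [Ring T] [Algebra k T] {𝒯 : ℤ → Submodule k T} {μ : A →ₗ[k] B →ₗ[k] T}
  {brT : T →ₗ[k] T →ₗ[k] T}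

set_option maxHeartbeats 1000000 in
/-- Pairs satisfying the defining relations for `A` and `B` combine, via
`m (a ⊗ b) = m a ⊗ m b` and `h (a ⊗ b) = m a ⊗ h b + (-1) ^ (|b| * p) h a ⊗ m b`, to a pair
satisfying the defining relations for `A ⊗ B`. -/
theorem IsUEPair.tensor
    (PA : IsDGPoissonAlgebra k A 𝒜 dA brA p) (PB : IsDGPoissonAlgebra k B ℬ dB brB p)
    (gB : SetLike.GradedMonoid ℬ)
    (HA : IsUEPair 𝒜 brA p mA hA) (HB : IsUEPair ℬ brB p mB hB)
    (hT : RealizesGradedTensorAlg k A B T 𝒜 ℬ 𝒯 μ)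
    (hbr : ∀ (i₁ j₁ i₂ j₂ : ℤ) (a₁ a₂ : A) (b₁ b₂ : B),
      a₁ ∈ 𝒜 i₁ → b₁ ∈ ℬ j₁ → a₂ ∈ 𝒜 i₂ → b₂ ∈ ℬ j₂ →
      brT (μ a₁ b₁) (μ a₂ b₂) =
        ((-1 : k) ^ ((i₂ + p) * j₁)) • μ (brA a₁ a₂) (b₁ * b₂) +
        ((-1 : k) ^ ((j₁ + p) * i₂)) • μ (a₁ * a₂) (brB b₁ b₂))
    (hE : RealizesGradedTensorAlg k U V E 𝒰 𝒱 ℰ ν)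
    (mA_mem : ∀ i, ∀ a ∈ 𝒜 i, mA a ∈ 𝒰 i) (hA_mem : ∀ i, ∀ a ∈ 𝒜 i, hA a ∈ 𝒰 (i + p))
    (mB_mem : ∀ i, ∀ b ∈ ℬ i, mB b ∈ 𝒱 i) (hB_mem : ∀ i, ∀ b ∈ ℬ i, hB b ∈ 𝒱 (i + p))
    {m h : T →ₗ[k] E} (hm : ∀ a b, m (μ a b) = ν (mA a) (mB b))
    (hh : ∀ j a, ∀ b ∈ ℬ j,
      h (μ a b) = ν (mA a) (hB b) + (-1 : k) ^ (j * p) • ν (hA a) (mB b)) :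
    IsUEPair 𝒯 brT p m h where
  mul_m l₁ l₂ t₁ t₂ ht₁ ht₂ := by
    refine hT.toRealizesGradedTensor.eq_of_mem₂ (f := (LinearMap.mul k T).compr₂ m)
      (g := (LinearMap.mul k E).compl₁₂ m m) ?_ ht₁ ht₂
    rintro i₁ j₁ i₂ j₂ rfl rfl a₁ ha₁ b₁ hb₁ a₂ ha₂ b₂ hb₂
    simp only [LinearMap.compr₂_apply, LinearMap.mul_apply', LinearMap.compl₁₂_apply,
      hT.mul _ _ _ _ _ _ _ _ ha₁ hb₁ ha₂ hb₂, map_smul, hm,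
      hE.mul _ _ _ _ _ _ _ _ (mA_mem _ _ ha₁) (mB_mem _ _ hb₁) (mA_mem _ _ ha₂)
        (mB_mem _ _ hb₂), HA.mul_m _ _ _ _ ha₁ ha₂, HB.mul_m _ _ _ _ hb₁ hb₂]
  br_h l₁ l₂ t₁ t₂ ht₁ ht₂ := by
    refine hT.toRealizesGradedTensor.eq_of_mem₂ (f := brT.compr₂ h)
      (g := (LinearMap.mul k E).compl₁₂ h h -
        (-1 : k) ^ ((l₁ + p) * (l₂ + p)) • ((LinearMap.mul k E).compl₁₂ h h).flip) ?_ ht₁ ht₂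
    rintro i₁ j₁ i₂ j₂ rfl rfl a₁ ha₁ b₁ hb₁ a₂ ha₂ b₂ hb₂
    have mA₁ := mA_mem _ _ ha₁
    have mA₂ := mA_mem _ _ ha₂
    have mB₁ := mB_mem _ _ hb₁
    have mB₂ := mB_mem _ _ hb₂
    have hA₁ := hA_mem _ _ ha₁
    have hA₂ := hA_mem _ _ ha₂
    have hB₁ := hB_mem _ _ hb₁
    have hB₂ := hB_mem _ _ hb₂
    simp only [LinearMap.compr₂_apply, LinearMap.mul_apply', LinearMap.compl₁₂_apply,
      LinearMap.sub_apply, LinearMap.smul_apply, LinearMap.flip_apply,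
      hbr _ _ _ _ _ _ _ _ ha₁ hb₁ ha₂ hb₂, map_add, map_smul,
      hh _ _ _ hb₁, hh _ _ _ hb₂, hh _ _ _ (gB.mul_mem hb₁ hb₂),
      hh _ _ _ (PB.br_mem _ _ _ _ hb₁ hb₂), add_mul, mul_add,
      hE.mul _ _ _ _ _ _ _ _ mA₁ hB₁ mA₂ hB₂, hE.mul _ _ _ _ _ _ _ _ hA₁ mB₁ mA₂ hB₂,
      hE.mul _ _ _ _ _ _ _ _ mA₁ hB₁ hA₂ mB₂, hE.mul _ _ _ _ _ _ _ _ hA₁ mB₁ hA₂ mB₂,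
      hE.mul _ _ _ _ _ _ _ _ mA₂ hB₂ mA₁ hB₁, hE.mul _ _ _ _ _ _ _ _ hA₂ mB₂ mA₁ hB₁,
      hE.mul _ _ _ _ _ _ _ _ mA₂ hB₂ hA₁ mB₁, hE.mul _ _ _ _ _ _ _ _ hA₂ mB₂ hA₁ mB₁,
      ← HA.mul_m _ _ _ _ ha₁ ha₂, ← HB.mul_m _ _ _ _ hb₁ hb₂,
      HA.m_mul_m_comm PA ha₁ ha₂, HB.m_mul_m_comm PB hb₁ hb₂,
      HA.mul_h _ _ _ _ ha₁ ha₂, HB.mul_h _ _ _ _ hb₁ hb₂,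
      HA.h_mul_m ha₁ ha₂, HB.h_mul_m hb₁ hb₂,
      HA.h_mul_m_comm PA ha₁ ha₂, HB.h_mul_m_comm PB hb₁ hb₂,
      HA.h_mul_h ha₁ ha₂, HB.h_mul_h hb₁ hb₂,
      map_neg, LinearMap.add_apply, LinearMap.smul_apply, LinearMap.neg_apply]
    have hne : (-1 : k) ≠ 0 := neg_ne_zero.2 one_ne_zero
    match_scalars <;>
      simp only [mul_one, mul_neg, neg_neg, ← zpow_add₀ hne, eq_comm (a := (0 : k)),
        sub_eq_zero] <;>
      refine neg_one_zpow_congr_zmod ?_ <;> push_cast <;>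
      generalize (i₁ : ZMod 2) = x₁, (i₂ : ZMod 2) = x₂, (j₁ : ZMod 2) = y₁,
        (j₂ : ZMod 2) = y₂, (p : ZMod 2) = q <;>
      revert x₁ x₂ y₁ y₂ q <;> decide
  mul_h l₁ l₂ t₁ t₂ ht₁ ht₂ := by
    refine hT.toRealizesGradedTensor.eq_of_mem₂ (f := (LinearMap.mul k T).compr₂ h)
      (g := (LinearMap.mul k E).compl₁₂ m h +
        (-1 : k) ^ (l₁ * l₂) • ((LinearMap.mul k E).compl₁₂ m h).flip) ?_ ht₁ ht₂
    rintro i₁ j₁ i₂ j₂ rfl rfl a₁ ha₁ b₁ hb₁ a₂ ha₂ b₂ hb₂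
    have mA₁ := mA_mem _ _ ha₁
    have mA₂ := mA_mem _ _ ha₂
    have mB₁ := mB_mem _ _ hb₁
    have mB₂ := mB_mem _ _ hb₂
    have hA₁ := hA_mem _ _ ha₁
    have hA₂ := hA_mem _ _ ha₂
    have hB₁ := hB_mem _ _ hb₁
    have hB₂ := hB_mem _ _ hb₂
    simp only [LinearMap.compr₂_apply, LinearMap.mul_apply', LinearMap.compl₁₂_apply,
      LinearMap.add_apply, LinearMap.smul_apply, LinearMap.flip_apply,
      hT.mul _ _ _ _ _ _ _ _ ha₁ hb₁ ha₂ hb₂, map_smul, hm,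
      hh _ _ _ hb₁, hh _ _ _ hb₂, hh _ _ _ (gB.mul_mem hb₁ hb₂), mul_add,
      hE.mul _ _ _ _ _ _ _ _ mA₁ mB₁ mA₂ hB₂, hE.mul _ _ _ _ _ _ _ _ mA₁ mB₁ hA₂ mB₂,
      hE.mul _ _ _ _ _ _ _ _ mA₂ mB₂ mA₁ hB₁, hE.mul _ _ _ _ _ _ _ _ mA₂ mB₂ hA₁ mB₁,
      ← HA.mul_m _ _ _ _ ha₁ ha₂, ← HB.mul_m _ _ _ _ hb₁ hb₂,
      HA.m_mul_m_comm PA ha₁ ha₂, HB.m_mul_m_comm PB hb₁ hb₂,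
      HA.mul_h _ _ _ _ ha₁ ha₂, HB.mul_h _ _ _ _ hb₁ hb₂,
      map_add, LinearMap.add_apply, LinearMap.smul_apply]
    have hne : (-1 : k) ≠ 0 := neg_ne_zero.2 one_ne_zero
    match_scalars <;>
      simp only [mul_one, ← zpow_add₀ hne] <;>
      refine neg_one_zpow_congr_zmod ?_ <;> push_cast <;>
      generalize (i₁ : ZMod 2) = x₁, (i₂ : ZMod 2) = x₂, (j₁ : ZMod 2) = y₁,
        (j₂ : ZMod 2) = y₂, (p : ZMod 2) = q <;>
      revert x₁ x₂ y₁ y₂ q <;> decide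
  br_m l₁ l₂ t₁ t₂ ht₁ ht₂ := by
    refine hT.toRealizesGradedTensor.eq_of_mem₂ (f := brT.compr₂ m)
      (g := (LinearMap.mul k E).compl₁₂ h m -
        (-1 : k) ^ ((l₁ + p) * l₂) • ((LinearMap.mul k E).compl₁₂ m h).flip) ?_ ht₁ ht₂
    rintro i₁ j₁ i₂ j₂ rfl rfl a₁ ha₁ b₁ hb₁ a₂ ha₂ b₂ hb₂
    have mA₁ := mA_mem _ _ ha₁
    have mA₂ := mA_mem _ _ ha₂
    have mB₁ := mB_mem _ _ hb₁
    have mB₂ := mB_mem _ _ hb₂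
    have hA₁ := hA_mem _ _ ha₁
    have hB₁ := hB_mem _ _ hb₁
    simp only [LinearMap.compr₂_apply, LinearMap.mul_apply', LinearMap.compl₁₂_apply,
      LinearMap.sub_apply, LinearMap.smul_apply, LinearMap.flip_apply,
      hbr _ _ _ _ _ _ _ _ ha₁ hb₁ ha₂ hb₂, map_add, map_smul, hm,
      hh _ _ _ hb₁, add_mul, mul_add,
      hE.mul _ _ _ _ _ _ _ _ mA₁ hB₁ mA₂ mB₂, hE.mul _ _ _ _ _ _ _ _ hA₁ mB₁ mA₂ mB₂,
      hE.mul _ _ _ _ _ _ _ _ mA₂ mB₂ mA₁ hB₁, hE.mul _ _ _ _ _ _ _ _ mA₂ mB₂ hA₁ mB₁,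
      ← HA.mul_m _ _ _ _ ha₁ ha₂, ← HB.mul_m _ _ _ _ hb₁ hb₂,
      HA.m_mul_m_comm PA ha₁ ha₂, HB.m_mul_m_comm PB hb₁ hb₂,
      HA.h_mul_m ha₁ ha₂, HB.h_mul_m hb₁ hb₂, LinearMap.add_apply, LinearMap.smul_apply]
    have hne : (-1 : k) ≠ 0 := neg_ne_zero.2 one_ne_zero
    match_scalars <;>
      simp only [mul_one, ← zpow_add₀ hne, eq_comm (a := (0 : k)), sub_eq_zero] <;>
      refine neg_one_zpow_congr_zmod ?_ <;> push_cast <;>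
      generalize (i₁ : ZMod 2) = x₁, (i₂ : ZMod 2) = x₂, (j₁ : ZMod 2) = y₁,
        (j₂ : ZMod 2) = y₂, (p : ZMod 2) = q <;>
      revert x₁ x₂ y₁ y₂ q <;> decide
  one_m := by rw [← hT.one, hm, HA.one_m, HB.one_m, hE.one]

end TensorPair

section TensorFactors

variable {k : Type} [Field k]
  {A : Type} [Ring A] [Algebra k A] {𝒜 : ℤ → Submodule k A} {dA : A →ₗ[k] A}
  {brA : A →ₗ[k] A →ₗ[k] A}
  {B : Type} [Ring B] [Algebra k B] {ℬ : ℤ → Submodule k B} {dB : B →ₗ[k] B}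
  {brB : B →ₗ[k] B →ₗ[k] B} {p : ℤ}
  {T : Type} [Ring T] [Algebra k T] {𝒯 : ℤ → Submodule k T} {μ : A →ₗ[k] B →ₗ[k] T}
  {brT : T →ₗ[k] T →ₗ[k] T} {R : Type} [Ring R] [Algebra k R] {m h : T →ₗ[k] R}

/-- A pair satisfying the defining relations for `A ⊗ B` restricts to such a pair for `A`. -/
theorem IsUEPair.comp_inl
    (PB : IsDGPoissonAlgebra k B ℬ dB brB p)
    (gB : SetLike.GradedMonoid ℬ) (hT : RealizesGradedTensorAlg k A B T 𝒜 ℬ 𝒯 μ)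
    (hbr : ∀ (i₁ j₁ i₂ j₂ : ℤ) (a₁ a₂ : A) (b₁ b₂ : B),
      a₁ ∈ 𝒜 i₁ → b₁ ∈ ℬ j₁ → a₂ ∈ 𝒜 i₂ → b₂ ∈ ℬ j₂ →
      brT (μ a₁ b₁) (μ a₂ b₂) =
        ((-1 : k) ^ ((i₂ + p) * j₁)) • μ (brA a₁ a₂) (b₁ * b₂) +
        ((-1 : k) ^ ((j₁ + p) * i₂)) • μ (a₁ * a₂) (brB b₁ b₂))
    (H : IsUEPair 𝒯 brT p m h) :
    IsUEPair 𝒜 brA p (m.comp (μ.flip 1)) (h.comp (μ.flip 1)) := by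
  have h1 := gB.one_mem
  refine H.comp _ ?_ ?_ ?_ ?_
  · intro i a ha
    simpa using hT.toRealizesGradedTensor.mem i 0 a 1 ha h1
  · simpa using hT.one
  · intro i j a ha b hb
    simp [hT.mul i 0 j 0 a b 1 1 ha h1 hb h1]
  · intro i j a ha b hb
    simp [hbr i 0 j 0 a b 1 1 ha h1 hb h1, PB.br_one h1 h1]

/-- A pair satisfying the defining relations for `A ⊗ B` restricts to such a pair for `B`. -/
theorem IsUEPair.comp_inr
    (PA : IsDGPoissonAlgebra k A 𝒜 dA brA p) (gA : SetLike.GradedMonoid 𝒜)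
    (hT : RealizesGradedTensorAlg k A B T 𝒜 ℬ 𝒯 μ)
    (hbr : ∀ (i₁ j₁ i₂ j₂ : ℤ) (a₁ a₂ : A) (b₁ b₂ : B),
      a₁ ∈ 𝒜 i₁ → b₁ ∈ ℬ j₁ → a₂ ∈ 𝒜 i₂ → b₂ ∈ ℬ j₂ →
      brT (μ a₁ b₁) (μ a₂ b₂) =
        ((-1 : k) ^ ((i₂ + p) * j₁)) • μ (brA a₁ a₂) (b₁ * b₂) +
        ((-1 : k) ^ ((j₁ + p) * i₂)) • μ (a₁ * a₂) (brB b₁ b₂))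
    (H : IsUEPair 𝒯 brT p m h) :
    IsUEPair ℬ brB p (m.comp (μ 1)) (h.comp (μ 1)) := by
  have h1 := gA.one_mem
  refine H.comp _ ?_ ?_ ?_ ?_
  · intro i b hb
    simpa using hT.toRealizesGradedTensor.mem 0 i 1 b h1 hb
  · exact hT.one
  · intro i j a ha b hb
    simp [hT.mul 0 i 0 j 1 1 a b h1 ha h1 hb]
  · intro i j a ha b hb
    simp [hbr 0 i 0 j 1 1 a b h1 ha h1 hb, PA.br_one h1 h1]

/-- For a pair satisfying the defining relations for `A ⊗ B`, the values on the two factors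
graded-commute, and the values on pure tensors are determined by those on the two factors. -/
theorem IsUEPair.tensor_factors
    (PA : IsDGPoissonAlgebra k A 𝒜 dA brA p) (PB : IsDGPoissonAlgebra k B ℬ dB brB p)
    (gA : SetLike.GradedMonoid 𝒜) (gB : SetLike.GradedMonoid ℬ)
    (hT : RealizesGradedTensorAlg k A B T 𝒜 ℬ 𝒯 μ)
    (hbr : ∀ (i₁ j₁ i₂ j₂ : ℤ) (a₁ a₂ : A) (b₁ b₂ : B),
      a₁ ∈ 𝒜 i₁ → b₁ ∈ ℬ j₁ → a₂ ∈ 𝒜 i₂ → b₂ ∈ ℬ j₂ →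
      brT (μ a₁ b₁) (μ a₂ b₂) =
        ((-1 : k) ^ ((i₂ + p) * j₁)) • μ (brA a₁ a₂) (b₁ * b₂) +
        ((-1 : k) ^ ((j₁ + p) * i₂)) • μ (a₁ * a₂) (brB b₁ b₂))
    (H : IsUEPair 𝒯 brT p m h) {i j : ℤ} {a : A} {b : B} (ha : a ∈ 𝒜 i) (hb : b ∈ ℬ j) :
    m (μ 1 b) * m (μ a 1) = (-1 : k) ^ (i * j) • (m (μ a 1) * m (μ 1 b)) ∧
    m (μ 1 b) * h (μ a 1) = (-1 : k) ^ ((i + p) * j) • (h (μ a 1) * m (μ 1 b)) ∧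
    h (μ 1 b) * m (μ a 1) = (-1 : k) ^ (i * (j + p)) • (m (μ a 1) * h (μ 1 b)) ∧
    h (μ 1 b) * h (μ a 1) = (-1 : k) ^ ((i + p) * (j + p)) • (h (μ a 1) * h (μ 1 b)) ∧
    m (μ a b) = m (μ a 1) * m (μ 1 b) ∧
    h (μ a b) = m (μ a 1) * h (μ 1 b) + (-1 : k) ^ (j * p) • (h (μ a 1) * m (μ 1 b)) := by
  have h1A := gA.one_mem
  have h1B := gB.one_mem
  have ma : μ a 1 ∈ 𝒯 i := by simpa using hT.toRealizesGradedTensor.mem i 0 a 1 ha h1B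
  have mb : μ 1 b ∈ 𝒯 j := by simpa using hT.toRealizesGradedTensor.mem 0 j 1 b h1A hb
  have ab : μ a 1 * μ 1 b = μ a b := by simp [hT.mul i 0 0 j a 1 1 b ha h1B h1A hb]
  have ba : μ 1 b * μ a 1 = (-1 : k) ^ (i * j) • μ a b := by
    simp [hT.mul 0 j i 0 1 a b 1 h1A hb ha h1B]
  have br₁ : brT (μ a 1) (μ 1 b) = 0 := by
    simp [hbr i 0 0 j a 1 1 b ha h1B h1A hb, PA.br_one h1A ha, PB.one_br h1B hb]
  have br₂ : brT (μ 1 b) (μ a 1) = 0 := by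
    simp [hbr 0 j i 0 1 a b 1 h1A hb ha h1B, PB.br_one h1B hb, PA.one_br h1A ha]
  have mm : m (μ a b) = m (μ a 1) * m (μ 1 b) := by rw [← ab, H.mul_m i j _ _ ma mb]
  have hm' : m (μ 1 b) * h (μ a 1) = (-1 : k) ^ ((i + p) * j) • (h (μ a 1) * m (μ 1 b)) := by
    have := H.br_m i j _ _ ma mb
    rw [br₁, map_zero, eq_comm, sub_eq_zero] at this
    rw [this, neg_one_zpow_smul_smul]
  refine ⟨?_, hm', ?_, ?_, mm, ?_⟩
  · rw [← H.mul_m j i _ _ mb ma, ba, map_smul, mm]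
  · have := H.br_m j i _ _ mb ma
    rwa [br₂, map_zero, eq_comm, sub_eq_zero, mul_comm] at this
  · have := H.br_h j i _ _ mb ma
    rwa [br₂, map_zero, eq_comm, sub_eq_zero, mul_comm] at this
  · rw [← ab, H.mul_h i j _ _ ma mb, hm', smul_smul,
      ← zpow_add₀ (neg_ne_zero.2 one_ne_zero)]
    congr 2
    refine neg_one_zpow_congr ?_
    simp only [Int.even_add, Int.even_mul]
    grind

end TensorFactors

/-- Let `A`, `B` be DG Poisson algebras with Poisson brackets of the same
degree `p`.  Then there is an isomorphism of DG algebras `(A ⊗ B)^{ue} ≅ A^{ue} ⊗ B^{ue}`,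
where `A ⊗ B` (realized by `T`) carries the tensor product DG Poisson algebra structure and
`A^{ue} ⊗ B^{ue}` (realized by `E`) is the graded tensor product of DG algebras. -/
theorem ue_of_tensor_iso_tensor_of_ue
    (k : Type) [Field k]
    (A : Type) [Ring A] [Algebra k A]
    (𝒜 : ℤ → Submodule k A) [GradedAlgebra 𝒜] (dA : A →ₗ[k] A)
    (brA : A →ₗ[k] A →ₗ[k] A)
    (B : Type) [Ring B] [Algebra k B]
    (ℬ : ℤ → Submodule k B) [GradedAlgebra ℬ] (dB : B →ₗ[k] B)
    (brB : B →ₗ[k] B →ₗ[k] B) (p : ℤ)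
    (hA : IsDGPoissonAlgebra k A 𝒜 dA brA p)
    (hB : IsDGPoissonAlgebra k B ℬ dB brB p)
    -- `T` realizes the tensor product DG Poisson algebra `A ⊗ B`
    (T : Type) [Ring T] [Algebra k T]
    (𝒯 : ℤ → Submodule k T) (μT : A →ₗ[k] B →ₗ[k] T)
    (hT : RealizesGradedTensorAlg k A B T 𝒜 ℬ 𝒯 μT)
    (dT : T →ₗ[k] T)
    (hdT : ∀ (i j : ℤ) (a : A) (b : B), a ∈ 𝒜 i → b ∈ ℬ j →
      dT (μT a b) = μT (dA a) b + ((-1 : k) ^ i) • μT a (dB b))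
    (brT : T →ₗ[k] T →ₗ[k] T)
    (hbrT : ∀ (i₁ j₁ i₂ j₂ : ℤ) (a₁ a₂ : A) (b₁ b₂ : B),
      a₁ ∈ 𝒜 i₁ → b₁ ∈ ℬ j₁ → a₂ ∈ 𝒜 i₂ → b₂ ∈ ℬ j₂ →
      brT (μT a₁ b₁) (μT a₂ b₂) =
        ((-1 : k) ^ ((i₂ + p) * j₁)) • μT (brA a₁ a₂) (b₁ * b₂) +
        ((-1 : k) ^ ((j₁ + p) * i₂)) • μT (a₁ * a₂) (brB b₁ b₂))
    -- the canonical DG-algebra structures on `A^{ue}`, `B^{ue}` and `(A ⊗ B)^{ue}`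
    (ℬA : ℤ → Submodule k (UEA k A 𝒜 brA p))
    (DA : UEA k A 𝒜 brA p →ₗ[k] UEA k A 𝒜 brA p)
    (hueA : IsUEADG k A 𝒜 dA brA p ℬA DA)
    (ℬB : ℤ → Submodule k (UEA k B ℬ brB p))
    (DB : UEA k B ℬ brB p →ₗ[k] UEA k B ℬ brB p)
    (hueB : IsUEADG k B ℬ dB brB p ℬB DB)
    (ℬT : ℤ → Submodule k (UEA k T 𝒯 brT p))
    (DT : UEA k T 𝒯 brT p →ₗ[k] UEA k T 𝒯 brT p)
    (hueT : IsUEADG k T 𝒯 dT brT p ℬT DT)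
    -- `E` realizes the graded tensor product DG algebra `A^{ue} ⊗ B^{ue}`
    (E : Type) [Ring E] [Algebra k E]
    (ℰ : ℤ → Submodule k E)
    (ν : UEA k A 𝒜 brA p →ₗ[k] UEA k B ℬ brB p →ₗ[k] E)
    (hE : RealizesGradedTensorAlg k (UEA k A 𝒜 brA p) (UEA k B ℬ brB p) E ℬA ℬB ℰ ν)
    (dE : E →ₗ[k] E)
    (hdE : ∀ (i j : ℤ) (x : UEA k A 𝒜 brA p) (y : UEA k B ℬ brB p),
      x ∈ ℬA i → y ∈ ℬB j →
      dE (ν x y) = ν (DA x) y + ((-1 : k) ^ i) • ν x (DB y)) :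
    ∃ Φ : UEA k T 𝒯 brT p →ₐ[k] E,
      Function.Bijective Φ ∧
      (∀ (i : ℤ) (x : UEA k T 𝒯 brT p), x ∈ ℬT i → Φ x ∈ ℰ i) ∧
      (∀ x : UEA k T 𝒯 brT p, Φ (DT x) = dE (Φ x)) := by
  have gA : SetLike.GradedMonoid 𝒜 := inferInstance
  have gB : SetLike.GradedMonoid ℬ := inferInstance
  have tA : ⨆ i, 𝒜 i = ⊤ := iSup_eq_top_of_decomposition 𝒜
  have tB : ⨆ i, ℬ i = ⊤ := iSup_eq_top_of_decomposition ℬ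
  have tT : ⨆ i, 𝒯 i = ⊤ := hT.toRealizesGradedTensor.iSup_eq_top tA tB
  have tUA := hueA.iSup_eq_top
  have tUB := hueB.iSup_eq_top
  have gUA := hueA.dga.graded_monoid
  have gUB := hueB.dga.graded_monoid
  have HA : IsUEPair 𝒜 brA p _ _ := isUEPair_ue
  have HB : IsUEPair ℬ brB p _ _ := isUEPair_ue
  have HT : IsUEPair 𝒯 brT p _ _ := isUEPair_ue
  -- the pair of linear maps defining `Φ`
  let m : T →ₗ[k] E := hT.toRealizesGradedTensor.desc
    (ν.compl₁₂ (ueM k A 𝒜 brA p) (ueM k B ℬ brB p))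
  let h : T →ₗ[k] E := hT.toRealizesGradedTensor.desc
    (ν.compl₁₂ (ueM k A 𝒜 brA p) (ueH k B ℬ brB p) +
      ν.compl₁₂ (ueH k A 𝒜 brA p) ((ueM k B ℬ brB p).comp (signTwist ℬ p)))
  have hm : ∀ a b, m (μT a b) = ν (ueM k A 𝒜 brA p a) (ueM k B ℬ brB p b) := fun a b => by
    simp [m, RealizesGradedTensor.desc_apply]
  have hh : ∀ j a, ∀ b ∈ ℬ j, h (μT a b) = ν (ueM k A 𝒜 brA p a) (ueH k B ℬ brB p b) +
      (-1 : k) ^ (j * p) • ν (ueH k A 𝒜 brA p a) (ueM k B ℬ brB p b) := fun j a b hb => by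
    simp [h, RealizesGradedTensor.desc_apply, signTwist_of_mem ℬ p hb]
  have HE : IsUEPair 𝒯 brT p m h := IsUEPair.tensor hA hB gB HA HB hT hbrT hE
    hueA.m_mem hueA.h_mem hueB.m_mem hueB.h_mem hm hh
  let Φ := HE.lift
  have ΦM : ∀ a b, Φ (ueM k T 𝒯 brT p (μT a b)) =
      ν (ueM k A 𝒜 brA p a) (ueM k B ℬ brB p b) := fun a b => by
    rw [HE.lift_ueM, hm]
  have ΦH : ∀ j a, ∀ b ∈ ℬ j, Φ (ueH k T 𝒯 brT p (μT a b)) =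
      ν (ueM k A 𝒜 brA p a) (ueH k B ℬ brB p b) +
      (-1 : k) ^ (j * p) • ν (ueH k A 𝒜 brA p a) (ueM k B ℬ brB p b) := fun j a b hb => by
    rw [HE.lift_ueH, hh j a b hb]
  -- the inverse of `Φ`
  let ΨA := (HT.comp_inl hB gB hT hbrT).lift
  let ΨB := (HT.comp_inr hA gA hT hbrT).lift
  have ΨAM : ∀ a, ΨA (ueM k A 𝒜 brA p a) = ueM k T 𝒯 brT p (μT a 1) :=
    IsUEPair.lift_ueM _
  have ΨAH : ∀ a, ΨA (ueH k A 𝒜 brA p a) = ueH k T 𝒯 brT p (μT a 1) :=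
    IsUEPair.lift_ueH _
  have ΨBM : ∀ b, ΨB (ueM k B ℬ brB p b) = ueM k T 𝒯 brT p (μT 1 b) :=
    IsUEPair.lift_ueM _
  have ΨBH : ∀ b, ΨB (ueH k B ℬ brB p b) = ueH k T 𝒯 brT p (μT 1 b) :=
    IsUEPair.lift_ueH _
  have factors := fun (i j : ℤ) (a : A) (b : B) (ha : a ∈ 𝒜 i) (hb : b ∈ ℬ j) =>
    HT.tensor_factors hA hB gA gB hT hbrT ha hb
  have commM : ∀ i j, ∀ x ∈ ℬA i, ∀ b ∈ ℬ j, ueM k T 𝒯 brT p (μT 1 b) * ΨA x =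
      (-1 : k) ^ (i * j) • (ΨA x * ueM k T 𝒯 brT p (μT 1 b)) := by
    intro i j x hx b hb
    refine hueA.graded_commute tA ΨA ?_ ?_ hx
    · intro i a ha
      rw [ΨAM]
      exact (factors i j a b ha hb).1
    · intro i a ha
      rw [ΨAH]
      exact (factors i j a b ha hb).2.1
  have commH : ∀ i j, ∀ x ∈ ℬA i, ∀ b ∈ ℬ j, ueH k T 𝒯 brT p (μT 1 b) * ΨA x =
      (-1 : k) ^ (i * (j + p)) • (ΨA x * ueH k T 𝒯 brT p (μT 1 b)) := by
    intro i j x hx b hb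
    refine hueA.graded_commute tA ΨA ?_ ?_ hx
    · intro i a ha
      rw [ΨAM]
      exact (factors i j a b ha hb).2.2.1
    · intro i a ha
      rw [ΨAH]
      exact (factors i j a b ha hb).2.2.2.1
  have comm : ∀ i j, ∀ x ∈ ℬA i, ∀ y ∈ ℬB j,
      ΨB y * ΨA x = (-1 : k) ^ (i * j) • (ΨA x * ΨB y) := by
    intro i j x hx y hy
    have := hueB.graded_commute tB ΨB (z := ΨA x) (n := i) ?_ ?_ hy
    · rw [mul_comm i j]
      exact eq_neg_one_zpow_smul (V := UEA k T 𝒯 brT p) this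
    · intro j b hb
      rw [ΨBM, mul_comm j i]
      exact eq_neg_one_zpow_smul (V := UEA k T 𝒯 brT p) (commM i j x hx b hb)
    · intro j b hb
      rw [ΨBH, mul_comm _ i]
      exact eq_neg_one_zpow_smul (V := UEA k T 𝒯 brT p) (commH i j x hx b hb)
  obtain ⟨Ψ, hΨ⟩ := hE.exists_algHom tUA tUB ΨA ΨB comm
  have ΨΦ : Ψ.comp Φ = AlgHom.id k _ := by
    refine UEA.algHom_ext ?_ ?_ <;>
      refine hT.toRealizesGradedTensor.hom_ext tA tB fun i j a ha b hb => ?_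
    · simpa [ΦM, hΨ, ΨAM, ΨBM] using (factors i j a b ha hb).2.2.2.2.1.symm
    · simpa [ΦH j a b hb, hΨ, ΨAM, ΨBM, ΨAH, ΨBH] using (factors i j a b ha hb).2.2.2.2.2.symm
  have ΦΨA : Φ.comp ΨA = hE.inl gUB.one_mem tUA := by
    refine UEA.algHom_ext ?_ ?_ <;> refine LinearMap.ext fun a => ?_
    · simp [ΨAM, ΦM, HB.one_m]
      rfl
    · simp [ΨAH, ΦH 0 a 1 gB.one_mem, HB.one_m, HB.h_one gB.one_mem]
      rfl
  have ΦΨB : Φ.comp ΨB = hE.inr gUA.one_mem tUB := by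
    refine UEA.algHom_ext ?_ ?_
    · refine LinearMap.ext fun b => ?_
      simp [ΨBM, ΦM, HA.one_m]
      rfl
    · refine LinearMap.ext_of_homogeneous tB fun j b hb => ?_
      simp [ΨBH, ΦH j 1 b hb, HA.one_m, HA.h_one gA.one_mem]
      rfl
  have ΦΨ : Φ.toLinearMap.comp Ψ.toLinearMap = LinearMap.id := by
    refine hE.toRealizesGradedTensor.hom_ext tUA tUB fun i j x hx y hy => ?_
    have h₁ : Φ (ΨA x) = ν x 1 := DFunLike.congr_fun ΦΨA x
    have h₂ : Φ (ΨB y) = ν 1 y := DFunLike.congr_fun ΦΨB y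
    simp [hΨ, h₁, h₂, hE.mul i 0 0 j x 1 1 y hx gUB.one_mem gUA.one_mem hy]
  -- compatibility with the gradings
  have memM : ∀ i, ∀ t ∈ 𝒯 i, Φ (ueM k T 𝒯 brT p t) ∈ ℰ i := by
    intro i t ht
    refine hT.toRealizesGradedTensor.le_of_tensor_mem
      (S := (ℰ i).comap (Φ.toLinearMap.comp (ueM k T 𝒯 brT p))) ?_ ht
    rintro i j rfl a ha b hb
    simpa [ΦM] using
      hE.toRealizesGradedTensor.mem _ _ _ _ (hueA.m_mem i a ha) (hueB.m_mem j b hb)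
  have memH : ∀ i, ∀ t ∈ 𝒯 i, Φ (ueH k T 𝒯 brT p t) ∈ ℰ (i + p) := by
    intro i t ht
    refine hT.toRealizesGradedTensor.le_of_tensor_mem
      (S := (ℰ (i + p)).comap (Φ.toLinearMap.comp (ueH k T 𝒯 brT p))) ?_ ht
    rintro i j rfl a ha b hb
    have h₁ := hE.toRealizesGradedTensor.mem _ _ _ _ (hueA.m_mem i a ha) (hueB.h_mem j b hb)
    have h₂ := hE.toRealizesGradedTensor.mem _ _ _ _ (hueA.h_mem i a ha) (hueB.m_mem j b hb)
    rw [← add_assoc] at h₁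
    rw [add_right_comm] at h₂
    simpa [ΦH j a b hb] using add_mem h₁ (Submodule.smul_mem _ ((-1 : k) ^ (j * p)) h₂)
  have mem : ∀ i, ∀ x ∈ ℬT i, Φ x ∈ ℰ i :=
    hueT.le_of_mul_mem tT (𝒮 := fun i => (ℰ i).comap Φ.toLinearMap)
      (by simpa using hE.one_mem gUA gUB)
      (fun i j t ht x _ hx => by simpa using hE.mul_mem gUA gUB (memM i t ht) hx)
      (fun i j t ht x _ hx => by simpa using hE.mul_mem gUA gUB (memH i t ht) hx)
  -- compatibility with the differentials
  have dM : ∀ t, Φ (DT (ueM k T 𝒯 brT p t)) = dE (Φ (ueM k T 𝒯 brT p t)) := by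
    refine LinearMap.congr_fun (f := Φ.toLinearMap ∘ₗ DT ∘ₗ ueM k T 𝒯 brT p)
      (g := dE ∘ₗ Φ.toLinearMap ∘ₗ ueM k T 𝒯 brT p) ?_
    refine hT.toRealizesGradedTensor.hom_ext tA tB fun i j a ha b hb => ?_
    simp [hueT.d_m, hdT i j a b ha hb, ΦM,
      hdE i j _ _ (hueA.m_mem i a ha) (hueB.m_mem j b hb), hueA.d_m, hueB.d_m]
  have dH : ∀ t, Φ (DT (ueH k T 𝒯 brT p t)) = dE (Φ (ueH k T 𝒯 brT p t)) := by
    refine LinearMap.congr_fun (f := Φ.toLinearMap ∘ₗ DT ∘ₗ ueH k T 𝒯 brT p)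
      (g := dE ∘ₗ Φ.toLinearMap ∘ₗ ueH k T 𝒯 brT p) ?_
    refine hT.toRealizesGradedTensor.hom_ext tA tB fun i j a ha b hb => ?_
    simp only [LinearMap.comp_apply, AlgHom.toLinearMap_apply, hueT.d_h, hdT i j a b ha hb,
      map_add, map_smul, ΦH j _ b hb, ΦH (j + 1) _ _ (hB.d_mem j b hb),
      hdE _ _ _ _ (hueA.m_mem i a ha) (hueB.h_mem j b hb),
      hdE _ _ _ _ (hueA.h_mem i a ha) (hueB.m_mem j b hb),
      hueA.d_m, hueA.d_h, hueB.d_m, hueB.d_h]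
    have hne : (-1 : k) ≠ 0 := neg_ne_zero.2 one_ne_zero
    match_scalars <;> simp only [mul_one, ← zpow_add₀ hne] <;>
      (refine neg_one_zpow_congr ?_
       simp only [Int.even_add, Int.even_mul]
       grind)
  have dstep : ∀ (i j : ℤ) (g x : UEA k T 𝒯 brT p), g ∈ ℬT i → x ∈ ℬT j →
      Φ (DT g) = dE (Φ g) → Φ (DT x) = dE (Φ x) → Φ (DT (g * x)) = dE (Φ (g * x)) := by
    intro i j g x hg hx hdg hdx
    rw [hueT.dga.d_mul i j g x hg hx, map_mul Φ g x,
      hE.d_mul hueA.dga hueB.dga (fun i j x hx y hy => hdE i j x y hx hy) (mem i g hg) (mem j x hx)]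
    simp [hdg, hdx]
  have d1 : Φ (DT 1) = dE (Φ 1) := by
    simpa [HT.one_m] using dM 1
  have d : ∀ i, ∀ x ∈ ℬT i, Φ (DT x) = dE (Φ x) :=
    hueT.le_of_mul_mem tT
      (𝒮 := fun _ => LinearMap.eqLocus (Φ.toLinearMap ∘ₗ DT) (dE ∘ₗ Φ.toLinearMap)) d1
      (fun i j t ht x hx hdx => dstep i j _ _ (hueT.m_mem i t ht) hx (dM t) hdx)
      (fun i j t ht x hx hdx => dstep _ j _ _ (hueT.h_mem i t ht) hx (dH t) hdx)
  refine ⟨Φ, ⟨?_, ?_⟩, mem, ?_⟩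
  · exact Function.LeftInverse.injective (g := Ψ) (DFunLike.congr_fun ΨΦ)
  · exact Function.RightInverse.surjective (g := Ψ) (LinearMap.congr_fun ΦΨ)
  · exact LinearMap.congr_fun (f := Φ.toLinearMap ∘ₗ DT) (g := dE ∘ₗ Φ.toLinearMap)
      (LinearMap.ext_of_homogeneous hueT.iSup_eq_top d)

end
end
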